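/- arXiv:1909.11441 — 3 statements merged into one kernel-verified Lean document; each statement's English description precedes it below -/
import Mathlib

section
/- Let N ≥ 2 and 1 < α < N. For every μ > 0 there exists η = η(μ, α, N) > 0 such that every measurable set E ⊆ ℝ^N with |E| = ω_N and δ(E) ≥ μ satisfies D(E) ≥ η. -/
open MeasureTheory Metric
open scoped symmDiff

noncomputable def rieszEnergy (N : ℕ) (α : ℝ) (E : Set (EuclideanSpace ℝ (Fin N))) : ℝ :=
  ∫ x in E, ∫ y in E, ‖y - x‖ ^ (α - (N : ℝ))

noncomputable def deficit (N : ℕ) (α : ℝ) (E : Set (EuclideanSpace ℝ (Fin N))) : ℝ :=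
  rieszEnergy N α (ball (0 : EuclideanSpace ℝ (Fin N)) 1) - rieszEnergy N α E

noncomputable def asymmetry (N : ℕ) (E : Set (EuclideanSpace ℝ (Fin N))) : ℝ :=
  ⨅ x : EuclideanSpace ℝ (Fin N), (volume (ball x 1 ∆ E)).toReal

open Set Filter Topology Module
open scoped ENNReal RealInnerProductSpace

section

variable {N : ℕ} {s : ℝ}

local notation "𝔼" => EuclideanSpace ℝ (Fin N)

/-- The potential `x ↦ ∫_A ‖y - x‖ ^ s dy` of a set, as an extended nonnegative number. -/
noncomputable def rieszPotential (s : ℝ) (A : Set 𝔼) (x : 𝔼) : ℝ≥0∞ :=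
  ∫⁻ y in A, ENNReal.ofReal (‖y - x‖ ^ s)

/-- The mutual interaction `∫_A ∫_B ‖y - x‖ ^ s dy dx` of two sets. -/
noncomputable def rieszInteraction (s : ℝ) (A B : Set 𝔼) : ℝ≥0∞ :=
  ∫⁻ x in A, rieszPotential s B x

lemma measurable_rieszKernel :
    Measurable fun p : 𝔼 × 𝔼 => ENNReal.ofReal (‖p.2 - p.1‖ ^ s) := by
  fun_prop

lemma measurable_rieszPotential (A : Set 𝔼) : Measurable (rieszPotential s A) :=
  Measurable.lintegral_prod_right' (ν := volume.restrict A) measurable_rieszKernel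

lemma rieszPotential_mono {A B : Set 𝔼} (h : A ⊆ B) (x : 𝔼) :
    rieszPotential s A x ≤ rieszPotential s B x :=
  lintegral_mono_set h

lemma rieszPotential_union_le (A B : Set 𝔼) (x : 𝔼) :
    rieszPotential s (A ∪ B) x ≤ rieszPotential s A x + rieszPotential s B x :=
  lintegral_union_le _ _ _

lemma rieszInteraction_mono {A A' B B' : Set 𝔼} (h : A ⊆ A') (h' : B ⊆ B') :
    rieszInteraction s A B ≤ rieszInteraction s A' B' :=
  (lintegral_mono_set h).trans (lintegral_mono fun x => rieszPotential_mono h' x)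

lemma rieszInteraction_comm (A B : Set 𝔼) :
    rieszInteraction s A B = rieszInteraction s B A := by
  unfold rieszInteraction rieszPotential
  rw [lintegral_lintegral_swap measurable_rieszKernel.aemeasurable]
  simp_rw [norm_sub_rev]

lemma rieszInteraction_union_left {A B : Set 𝔼} (hB : MeasurableSet B) (h : Disjoint A B)
    (D : Set 𝔼) :
    rieszInteraction s (A ∪ B) D = rieszInteraction s A D + rieszInteraction s B D :=
  lintegral_union hB h

lemma rieszInteraction_union_right {A B : Set 𝔼} (hB : MeasurableSet B) (h : Disjoint A B)
    (D : Set 𝔼) :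
    rieszInteraction s D (A ∪ B) = rieszInteraction s D A + rieszInteraction s D B := by
  simp only [rieszInteraction_comm D, rieszInteraction_union_left hB h]

lemma rieszInteraction_union_self {A B : Set 𝔼} (hB : MeasurableSet B) (h : Disjoint A B) :
    rieszInteraction s (A ∪ B) (A ∪ B) =
      rieszInteraction s A A + 2 * rieszInteraction s A B + rieszInteraction s B B := by
  rw [rieszInteraction_union_left hB h, rieszInteraction_union_right hB h,
    rieszInteraction_union_right hB h, rieszInteraction_comm B A]
  ring

lemma rieszInteraction_preimage {g : 𝔼 → 𝔼} (hg : Measurable g) {r : ℝ≥0∞}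
    (hmap : volume.map g = r • volume) {q : ℝ} (hq : 0 ≤ q)
    (hgq : ∀ x y, ‖g y - g x‖ = q * ‖y - x‖) {A B : Set 𝔼} (hA : MeasurableSet A)
    (hB : MeasurableSet B) :
    ENNReal.ofReal (q ^ s) * rieszInteraction s (g ⁻¹' A) (g ⁻¹' B) =
      r ^ 2 * rieszInteraction s A B := by
  have key : ∀ x, ENNReal.ofReal (q ^ s) * rieszPotential s (g ⁻¹' B) x =
      r * rieszPotential s B (g x) := by
    intro x
    have h := setLIntegral_map (μ := volume) (f := fun y => ENNReal.ofReal (‖y - g x‖ ^ s)) hB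
      (by fun_prop) hg
    rw [hmap, Measure.restrict_smul, lintegral_smul_measure, smul_eq_mul] at h
    rw [rieszPotential, rieszPotential, h, ← lintegral_const_mul _ (by fun_prop)]
    refine lintegral_congr fun y => ?_
    rw [hgq, Real.mul_rpow hq (norm_nonneg _), ENNReal.ofReal_mul (by positivity)]
  have h := setLIntegral_map (μ := volume) (f := rieszPotential s B) hA
    (measurable_rieszPotential B) hg
  rw [hmap, Measure.restrict_smul, lintegral_smul_measure, smul_eq_mul] at h
  have e : r ^ 2 * rieszInteraction s A B = r * (r * ∫⁻ x in A, rieszPotential s B x) := by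
    rw [rieszInteraction]; ring
  rw [e, h, rieszInteraction, ← lintegral_const_mul _ (measurable_rieszPotential _),
    ← lintegral_const_mul (f := fun x => rieszPotential s B (g x)) _
      ((measurable_rieszPotential _).comp hg)]
  exact lintegral_congr key

lemma rieszInteraction_preimage_of_isometry {g : 𝔼 → 𝔼} (hg : MeasurePreserving g)
    (hgi : Isometry g) {A B : Set 𝔼} (hA : MeasurableSet A) (hB : MeasurableSet B) :
    rieszInteraction s (g ⁻¹' A) (g ⁻¹' B) = rieszInteraction s A B := by
  have := rieszInteraction_preimage (s := s) hg.measurable (r := 1) (by simp [hg.map_eq])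
    zero_le_one (fun x y => by rw [← dist_eq_norm, hgi.dist_eq, dist_eq_norm, one_mul]) hA hB
  simpa using this

lemma lintegral_ball_rieszKernel_ne_top (hN : N ≠ 0) (hs : -(N : ℝ) < s) :
    ∫⁻ y in ball (0 : 𝔼) 1, ENNReal.ofReal (‖y‖ ^ s) ≠ ∞ := by
  have : Nonempty (Fin N) := ⟨⟨0, Nat.pos_of_ne_zero hN⟩⟩
  have h : IntegrableOn (fun y : 𝔼 => ‖y‖ ^ s) (ball 0 1) := by
    rw [integrableOn_fun_norm_addHaar volume (f := fun r => r ^ s)]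
    have h1 : IntegrableOn (fun y : ℝ => y ^ ((N : ℝ) - 1 + s)) (Ioo 0 1) :=
      (intervalIntegral.integrableOn_Ioo_rpow_iff one_pos).2 (by linarith)
    refine h1.congr_fun (fun y hy => ?_) measurableSet_Ioo
    have hN1 : ((N - 1 : ℕ) : ℝ) = (N : ℝ) - 1 := by
      rw [Nat.cast_sub (Nat.pos_of_ne_zero hN)]; simp
    simp only [finrank_euclideanSpace, Fintype.card_fin, smul_eq_mul]
    rw [Real.rpow_add hy.1, ← Real.rpow_natCast, hN1]
  exact h.lintegral_lt_top.ne

/-- The unit ball integral of the kernel bounds the short range part of every potential. -/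
lemma rieszPotential_le (hs : s < 0) {A : Set 𝔼} (hA : MeasurableSet A) (x : 𝔼) :
    rieszPotential s A x ≤
      (∫⁻ y in (· + x) ⁻¹' A ∩ ball (0 : 𝔼) 1, ENNReal.ofReal (‖y‖ ^ s)) + volume A := by
  have h1 : rieszPotential s A x = ∫⁻ y in (· + x) ⁻¹' A, ENNReal.ofReal (‖y‖ ^ s) := by
    rw [rieszPotential, ← (measurePreserving_add_right volume x).setLIntegral_comp_preimage hA
      (by fun_prop)]
    simp
  rw [h1, ← inter_union_sdiff ((· + x) ⁻¹' A) (ball (0 : 𝔼) 1)]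
  refine (lintegral_union_le _ _ _).trans ?_
  rw [inter_union_sdiff]
  gcongr
  calc ∫⁻ y in (· + x) ⁻¹' A \ ball (0 : 𝔼) 1, ENNReal.ofReal (‖y‖ ^ s)
      ≤ ∫⁻ _ in (· + x) ⁻¹' A \ ball (0 : 𝔼) 1, 1 := by
        refine setLIntegral_mono measurable_const fun y hy => ?_
        rw [ENNReal.ofReal_le_one]
        exact Real.rpow_le_one_of_one_le_of_nonpos (by simpa using hy.2) hs.le
    _ ≤ volume ((· + x) ⁻¹' A) := by
        rw [setLIntegral_one]; exact measure_mono sdiff_subset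
    _ = volume A := (measurePreserving_add_right volume x).measure_preimage hA.nullMeasurableSet

lemma exists_rieszPotential_le (hN : N ≠ 0) (hs : s < 0) (hs' : -(N : ℝ) < s) :
    ∃ K : ℝ≥0∞, K ≠ ∞ ∧ ∀ (A : Set 𝔼) (x : 𝔼), MeasurableSet A →
      rieszPotential s A x ≤ K + volume A :=
  ⟨_, lintegral_ball_rieszKernel_ne_top hN hs', fun A x hA => (rieszPotential_le hs hA x).trans <|
    by gcongr; exact inter_subset_right⟩

/-- Potentials of small sets are uniformly small. -/
lemma exists_rieszPotential_lt (hN : N ≠ 0) (hs : s < 0) (hs' : -(N : ℝ) < s) {ε : ℝ≥0∞}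
    (hε : ε ≠ 0) :
    ∃ δ : ℝ≥0∞, 0 < δ ∧ ∀ (A : Set 𝔼) (x : 𝔼), MeasurableSet A → volume A < δ →
      rieszPotential s A x < ε := by
  obtain ⟨δ, hδ, h⟩ := exists_pos_setLIntegral_lt_of_measure_lt
    (lintegral_ball_rieszKernel_ne_top hN hs') (ENNReal.half_pos hε).ne'
  refine ⟨min δ (ε / 2), lt_min hδ (ENNReal.half_pos hε), fun A x hA hlt => ?_⟩
  have h1 : volume ((· + x) ⁻¹' A) = volume A :=
    (measurePreserving_add_right volume x).measure_preimage hA.nullMeasurableSet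
  have h2 := h ((· + x) ⁻¹' A) ?_
  · rw [Measure.restrict_restrict (measurable_add_const x hA)] at h2
    calc _ ≤ _ := rieszPotential_le hs hA x
      _ < ε / 2 + ε / 2 := ENNReal.add_lt_add h2 (hlt.trans_le (min_le_right _ _))
      _ = ε := ENNReal.add_halves ε
  · exact (Measure.restrict_apply_le _ _).trans_lt (h1 ▸ hlt.trans_le (min_le_left _ _))

lemma rieszInteraction_le {A B : Set 𝔼} {K : ℝ≥0∞}
    (h : ∀ x ∈ A, rieszPotential s B x ≤ K) :
    rieszInteraction s A B ≤ K * volume A := by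
  calc rieszInteraction s A B ≤ ∫⁻ _ in A, K := setLIntegral_mono measurable_const h
    _ = K * volume A := by simp

/-- The supremum of the Riesz energies of the sets with the volume of the unit ball. -/
noncomputable def maxRieszEnergy (N : ℕ) (s : ℝ) : ℝ≥0∞ :=
  ⨆ (E : Set (EuclideanSpace ℝ (Fin N)))
    (_ : MeasurableSet E ∧ volume E = volume (ball (0 : EuclideanSpace ℝ (Fin N)) 1)),
    rieszInteraction s E E

lemma le_maxRieszEnergy {E : Set 𝔼} (hE : MeasurableSet E)
    (hvol : volume E = volume (ball (0 : 𝔼) 1)) :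
    rieszInteraction s E E ≤ maxRieszEnergy N s :=
  le_iSup₂_of_le (f := fun (E : Set 𝔼)
    (_ : MeasurableSet E ∧ volume E = volume (ball (0 : 𝔼) 1)) => rieszInteraction s E E)
    E ⟨hE, hvol⟩ le_rfl

/-- A uniform bound for the potentials of the sets with at most the volume of the unit ball. -/
lemma exists_rieszPotential_le_of_volume_le (hN : N ≠ 0) (hs : s < 0) (hs' : -(N : ℝ) < s) :
    ∃ K : ℝ, 0 < K ∧ ∀ (A : Set 𝔼) (x : 𝔼), MeasurableSet A →
      volume A ≤ volume (ball (0 : 𝔼) 1) → rieszPotential s A x ≤ ENNReal.ofReal K := by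
  obtain ⟨K, hK, h⟩ := exists_rieszPotential_le (N := N) hN hs hs'
  have hfin : K + volume (ball (0 : 𝔼) 1) ≠ ∞ := ENNReal.add_ne_top.2 ⟨hK, measure_ball_lt_top.ne⟩
  refine ⟨(K + volume (ball (0 : 𝔼) 1)).toReal, ENNReal.toReal_pos ?_ hfin, fun A x hA hle => ?_⟩
  · have := measure_ball_pos volume (0 : 𝔼) one_pos
    positivity
  · rw [ENNReal.ofReal_toReal hfin]
    exact (h A x hA).trans (by gcongr)

lemma maxRieszEnergy_ne_top (hN : N ≠ 0) (hs : s < 0) (hs' : -(N : ℝ) < s) :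
    maxRieszEnergy N s ≠ ∞ := by
  obtain ⟨K, -, h⟩ := exists_rieszPotential_le_of_volume_le (N := N) hN hs hs'
  have hfin : ENNReal.ofReal K * volume (ball (0 : 𝔼) 1) ≠ ∞ :=
    ENNReal.mul_ne_top ENNReal.ofReal_ne_top measure_ball_lt_top.ne
  refine ne_top_of_le_ne_top hfin (iSup₂_le fun E hE => ?_)
  rw [← hE.2]
  exact rieszInteraction_le fun x _ => h E x hE.1 hE.2.le

lemma maxRieszEnergy_pos (hN : N ≠ 0) : 0 < maxRieszEnergy N s := by
  have : Nonempty (Fin N) := ⟨⟨0, Nat.pos_of_ne_zero hN⟩⟩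
  refine lt_of_lt_of_le ?_ (le_maxRieszEnergy measurableSet_ball rfl)
  have hb := measure_ball_pos volume (0 : 𝔼) one_pos
  have hpot : ∀ x : 𝔼, 0 < rieszPotential s (ball (0 : 𝔼) 1) x := by
    intro x
    rw [rieszPotential, setLIntegral_pos_iff (by fun_prop)]
    have h0 : volume ({x} : Set 𝔼) = 0 := by simp
    have : ball (0 : 𝔼) 1 \ {x} ⊆
        Function.support (fun y => ENNReal.ofReal (‖y - x‖ ^ s)) ∩ ball (0 : 𝔼) 1 := by
      intro y hy
      refine ⟨?_, hy.1⟩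
      have : 0 < ‖y - x‖ := norm_pos_iff.2 (sub_ne_zero.2 hy.2)
      simp only [Function.mem_support, ne_eq, ENNReal.ofReal_eq_zero, not_le]
      positivity
    refine lt_of_lt_of_le ?_ (measure_mono this)
    rwa [measure_sdiff_null h0]
  rw [rieszInteraction, setLIntegral_pos_iff (measurable_rieszPotential _)]
  rwa [show Function.support (rieszPotential s (ball (0 : 𝔼) 1)) = univ from
    eq_univ_of_forall fun x => (hpot x).ne', univ_inter]

lemma rieszInteraction_self_le_of_volume_eq_mul {c : ℝ} (hc : 0 < c) {A : Set 𝔼}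
    (hA : MeasurableSet A)
    (hvol : volume A = ENNReal.ofReal (c ^ N) * volume (ball (0 : 𝔼) 1)) :
    rieszInteraction s A A ≤ ENNReal.ofReal (c ^ (2 * N + s)) * maxRieszEnergy N s := by
  have hcN : 0 < c ^ N := by positivity
  have hg : Measurable (c • · : 𝔼 → 𝔼) := by fun_prop
  have hmap := Measure.map_addHaar_smul (volume : Measure 𝔼) hc.ne'
  simp only [finrank_euclideanSpace, Fintype.card_fin] at hmap
  rw [abs_of_pos (by positivity)] at hmap
  have hv : volume ((c • · : 𝔼 → 𝔼) ⁻¹' A) = volume (ball (0 : 𝔼) 1) := by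
    rw [← Measure.map_apply hg hA, hmap, Measure.smul_apply, hvol, smul_eq_mul, ← mul_assoc,
      ← ENNReal.ofReal_mul (by positivity), inv_mul_cancel₀ hcN.ne', ENNReal.ofReal_one, one_mul]
  have h := rieszInteraction_preimage (s := s) hg hmap hc.le
    (fun x y => by rw [← smul_sub, norm_smul, Real.norm_of_nonneg hc.le]) hA hA
  have h2 : rieszInteraction s A A = ENNReal.ofReal (c ^ (2 * N + s)) *
      rieszInteraction s ((c • · : 𝔼 → 𝔼) ⁻¹' A) ((c • · : 𝔼 → 𝔼) ⁻¹' A) := by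
    have e1 : c ^ (2 * N + s) = (c ^ N) ^ 2 * c ^ s := by
      rw [Real.rpow_add hc, ← pow_mul, ← Real.rpow_natCast c (N * 2)]
      congr 2
      push_cast; ring
    rw [e1, ENNReal.ofReal_mul (by positivity), mul_assoc, h, ← mul_assoc,
      ← ENNReal.ofReal_pow (by positivity), ← ENNReal.ofReal_mul (by positivity), ← mul_pow,
      mul_inv_cancel₀ hcN.ne', one_pow, ENNReal.ofReal_one, one_mul]
  rw [h2]
  gcongr
  exact le_maxRieszEnergy (hg hA) hv

lemma toReal_rieszInteraction_self_le (hN : N ≠ 0) (hs : s < 0) (hs' : -(N : ℝ) < s)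
    {A : Set 𝔼} (hA : MeasurableSet A) (hfin : volume A ≠ ∞) :
    (rieszInteraction s A A).toReal ≤ (maxRieszEnergy N s).toReal *
      (volume.real A / volume.real (ball (0 : 𝔼) 1)) ^ (2 + s / N) := by
  have hb : 0 < volume.real (ball (0 : 𝔼) 1) :=
    ENNReal.toReal_pos (measure_ball_pos volume (0 : 𝔼) one_pos).ne' measure_ball_lt_top.ne
  have hN' : (0 : ℝ) < N := by exact_mod_cast Nat.pos_of_ne_zero hN
  rcases eq_or_ne (volume A) 0 with h0 | h0
  · have : rieszInteraction s A A = 0 :=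
      le_antisymm ((rieszInteraction_le (K := ∞) fun _ _ => le_top).trans (by simp [h0])) zero_le
    rw [this]
    simp only [ENNReal.toReal_zero]
    positivity
  set ρ := volume.real A / volume.real (ball (0 : 𝔼) 1) with hρ
  have hA' : 0 < volume.real A := ENNReal.toReal_pos h0 hfin
  have hρ0 : 0 < ρ := by positivity
  have hc : 0 < ρ ^ (1 / (N : ℝ)) := by positivity
  have hcN : (ρ ^ (1 / (N : ℝ))) ^ N = ρ := by
    rw [← Real.rpow_natCast, ← Real.rpow_mul hρ0.le]
    field_simp
    simp
  have hcs : (ρ ^ (1 / (N : ℝ))) ^ (2 * N + s) = ρ ^ (2 + s / N) := by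
    rw [← Real.rpow_mul hρ0.le]
    congr 1
    field_simp
  have h := rieszInteraction_self_le_of_volume_eq_mul (s := s) hc hA (by
    rw [hcN, ← ofReal_measureReal hfin, ← ofReal_measureReal measure_ball_lt_top.ne,
      ← ENNReal.ofReal_mul hρ0.le, hρ, div_mul_cancel₀ _ hb.ne'])
  rw [hcs] at h
  have h' := ENNReal.toReal_mono
    (ENNReal.mul_ne_top ENNReal.ofReal_ne_top (maxRieszEnergy_ne_top hN hs hs')) h
  rwa [ENNReal.toReal_mul, ENNReal.toReal_ofReal (by positivity), mul_comm] at h'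

lemma rieszInteraction_self_le_of_separated (hs : s < 0) {A G C : Set 𝔼} (hC : MeasurableSet C)
    (hG : MeasurableSet G) (hAC : Disjoint A C) (hACG : Disjoint (A ∪ C) G)
    {K : ℝ≥0∞} (hK : ∀ x, rieszPotential s ((A ∪ C) ∪ G) x ≤ K) {L : ℝ} (hL : 0 < L)
    (hsep : ∀ x ∈ A, ∀ y ∈ C, L ≤ ‖y - x‖) :
    rieszInteraction s ((A ∪ C) ∪ G) ((A ∪ C) ∪ G) ≤
      rieszInteraction s A A + rieszInteraction s C C +
        2 * (ENNReal.ofReal (L ^ s) * volume C * volume A) + 2 * (K * volume G) := by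
  have h1 : rieszInteraction s A C ≤ ENNReal.ofReal (L ^ s) * volume C * volume A := by
    refine rieszInteraction_le fun x hx => ?_
    calc rieszPotential s C x ≤ ∫⁻ _ in C, ENNReal.ofReal (L ^ s) :=
          setLIntegral_mono measurable_const fun y hy => ENNReal.ofReal_le_ofReal
            (Real.rpow_le_rpow_of_nonpos hL (hsep x hx y hy) hs.le)
      _ = _ := by simp
  have h2 : rieszInteraction s G ((A ∪ C) ∪ G) ≤ K * volume G :=
    rieszInteraction_le fun x _ => hK x
  rw [rieszInteraction_union_right hG hACG, rieszInteraction_comm G] at h2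
  rw [rieszInteraction_union_self hG hACG, rieszInteraction_union_self hC hAC]
  calc _ ≤ rieszInteraction s A A + 2 * rieszInteraction s A C + rieszInteraction s C C +
          2 * (rieszInteraction s (A ∪ C) G + rieszInteraction s G G) := by
        rw [mul_add, ← add_assoc]
        gcongr
        exact le_mul_of_one_le_left zero_le one_le_two
    _ ≤ rieszInteraction s A A + 2 * (ENNReal.ofReal (L ^ s) * volume C * volume A) +
          rieszInteraction s C C + 2 * (K * volume G) := by gcongr
    _ = _ := by ring

/-- A set of nearly maximal energy has a point where its potential is large, hence it has a
definite amount of mass in some ball of controlled radius. -/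
lemma exists_le_volume_inter_ball (hN : N ≠ 0) (hs : s < 0) (hs' : -(N : ℝ) < s) :
    ∃ R : ℝ, 0 < R ∧ ∃ δ : ℝ, 0 < δ ∧ ∀ E : Set 𝔼, MeasurableSet E →
      volume E = volume (ball (0 : 𝔼) 1) →
      (maxRieszEnergy N s).toReal / 2 < (rieszInteraction s E E).toReal →
      ∃ p : 𝔼, δ ≤ volume.real (E ∩ ball p R) := by
  have hω : 0 < volume.real (ball (0 : 𝔼) 1) :=
    ENNReal.toReal_pos (measure_ball_pos volume (0 : 𝔼) one_pos).ne' measure_ball_lt_top.ne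
  set ω := volume.real (ball (0 : 𝔼) 1) with hωdef
  have hωE : volume (ball (0 : 𝔼) 1) = ENNReal.ofReal ω :=
    (ofReal_measureReal measure_ball_lt_top.ne).symm
  have hM : 0 < (maxRieszEnergy N s).toReal :=
    ENNReal.toReal_pos (maxRieszEnergy_pos hN).ne' (maxRieszEnergy_ne_top hN hs hs')
  set M := (maxRieszEnergy N s).toReal
  have hMω : 0 < M / (4 * ω) := by positivity
  obtain ⟨δ, hδ, hsmall⟩ := exists_rieszPotential_lt (N := N) hN hs hs'
    (ENNReal.ofReal_pos.2 hMω).ne'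
  obtain ⟨R, hR, hRpos⟩ : ∃ R : ℝ, R ^ s < M / (4 * ω) / ω ∧ 0 < R := by
    have h := (tendsto_rpow_neg_atTop (neg_pos.2 hs)).eventually_lt_const
      (show (0 : ℝ) < M / (4 * ω) / ω by positivity)
    rw [neg_neg] at h
    exact (h.and (eventually_gt_atTop 0)).exists
  have hδ1 : min δ 1 ≠ ∞ := ne_top_of_le_ne_top ENNReal.one_ne_top (min_le_right _ _)
  refine ⟨R, hRpos, (min δ 1).toReal, ENNReal.toReal_pos (lt_min hδ one_pos).ne' hδ1,
    fun E hE hvol hen => ?_⟩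
  obtain ⟨p, -, hp⟩ : ∃ p ∈ E, ENNReal.ofReal (M / (2 * ω)) < rieszPotential s E p := by
    by_contra! hcon
    have h := rieszInteraction_le hcon
    rw [hvol, hωE, ← ENNReal.ofReal_mul (by positivity)] at h
    have h' := ENNReal.toReal_mono ENNReal.ofReal_ne_top h
    rw [ENNReal.toReal_ofReal (by positivity)] at h'
    have : M / (2 * ω) * ω = M / 2 := by field_simp
    linarith
  refine ⟨p, ?_⟩
  by_contra! hlt
  have hfin : volume (E ∩ ball p R) ≠ ∞ :=
    ne_top_of_le_ne_top measure_ball_lt_top.ne (measure_mono inter_subset_right)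
  have hlt' : volume (E ∩ ball p R) < δ :=
    ((ENNReal.toReal_lt_toReal hfin hδ1).1 hlt).trans_le (min_le_left _ _)
  have hnear := hsmall _ p (hE.inter measurableSet_ball) hlt'
  have hfar : rieszPotential s (E \ ball p R) p ≤ ENNReal.ofReal (M / (4 * ω)) := by
    calc rieszPotential s (E \ ball p R) p
        ≤ ∫⁻ _ in E \ ball p R, ENNReal.ofReal (M / (4 * ω) / ω) := by
          refine setLIntegral_mono measurable_const fun y hy => ENNReal.ofReal_le_ofReal ?_
          refine (Real.rpow_le_rpow_of_nonpos hRpos ?_ hs.le).trans hR.le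
          simpa [dist_eq_norm] using hy.2
      _ ≤ ENNReal.ofReal (M / (4 * ω) / ω) * volume E := by
          rw [setLIntegral_const]; gcongr; exact sdiff_subset
      _ = ENNReal.ofReal (M / (4 * ω)) := by
          rw [hvol, hωE, ← ENNReal.ofReal_mul (by positivity), div_mul_cancel₀ _ hω.ne']
  have h := rieszPotential_union_le (s := s) (E ∩ ball p R) (E \ ball p R) p
  rw [inter_union_sdiff] at h
  refine absurd (hp.trans_le h) (not_lt.2 ?_)
  calc _ ≤ ENNReal.ofReal (M / (4 * ω)) + ENNReal.ofReal (M / (4 * ω)) := by gcongr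
    _ = _ := by rw [← ENNReal.ofReal_add hMω.le hMω.le]; congr 1; field_simp; norm_num

lemma exists_annulus_volume_le {E : Set 𝔼} (hE : MeasurableSet E) (hfin : volume E ≠ ∞) (p : 𝔼)
    {R L : ℝ} (hL : 0 ≤ L) {J : ℕ} (hJ : J ≠ 0) :
    ∃ j < J, volume.real (E ∩ (ball p (R + (j + 1) * L) \ ball p (R + j * L))) ≤
      volume.real E / J := by
  set φ : ℕ → ℝ := fun j => volume.real (E ∩ ball p (R + j * L)) with hφ
  have hdiff : ∀ j : ℕ, volume.real (E ∩ (ball p (R + (j + 1) * L) \ ball p (R + j * L))) =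
      φ (j + 1) - φ j := by
    intro j
    have hsub : E ∩ ball p (R + j * L) ⊆ E ∩ ball p (R + (j + 1) * L) := by
      gcongr; linarith
    rw [inter_sdiff_distrib_left, measureReal_sdiff hsub (hE.inter measurableSet_ball)
      (ne_top_of_le_ne_top hfin (measure_mono inter_subset_left))]
    simp [hφ]
  have hsum : ∑ j ∈ Finset.range J, (φ (j + 1) - φ j) ≤
      ∑ _j ∈ Finset.range J, volume.real E / J := by
    rw [Finset.sum_range_sub, Finset.sum_const, Finset.card_range, nsmul_eq_mul,
      mul_div_cancel₀ _ (by exact_mod_cast hJ)]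
    have h1 : φ J ≤ volume.real E := measureReal_mono inter_subset_left hfin
    have h2 : 0 ≤ φ 0 := measureReal_nonneg
    linarith
  obtain ⟨j, hj, hle⟩ := Finset.exists_le_of_sum_le (by simpa using hJ) hsum
  exact ⟨j, Finset.mem_range.1 hj, (hdiff j).le.trans hle⟩

/-- The quantitative strict superadditivity of `t ↦ t ^ (1 + q)`. -/
lemma rpow_add_rpow_le_of_add_le_one {a c θ q : ℝ} (hq : 0 < q) (hθ : 0 < θ) (ha : θ ≤ a)
    (hc : θ ≤ c) (hac : a + c ≤ 1) :
    a ^ (1 + q) + c ^ (1 + q) ≤ (1 - θ) ^ q := by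
  have h : ∀ t, θ ≤ t → t ≤ 1 - θ → t ^ (1 + q) ≤ t * (1 - θ) ^ q := by
    intro t ht ht'
    rw [Real.rpow_add (hθ.trans_le ht), Real.rpow_one]
    have := hθ.trans_le ht
    gcongr
  have h1 := h a ha (by linarith)
  have h2 := h c hc (by linarith)
  have h3 : 0 ≤ (1 - θ) ^ q := Real.rpow_nonneg (by linarith) _
  nlinarith

/-- Sets of nearly maximal energy are tight up to translation. -/
lemma exists_volume_sdiff_ball_le (hN : N ≠ 0) (hs : s < 0) (hs' : -(N : ℝ) < s) {κ : ℝ}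
    (hκ : 0 < κ) :
    ∃ R : ℝ, 0 < R ∧ ∃ η : ℝ, 0 < η ∧ ∀ E : Set 𝔼, MeasurableSet E →
      volume E = volume (ball (0 : 𝔼) 1) →
      (maxRieszEnergy N s).toReal - η < (rieszInteraction s E E).toReal →
      ∃ p : 𝔼, volume.real (E \ ball p R) ≤ κ := by
  have hω : 0 < volume.real (ball (0 : 𝔼) 1) :=
    ENNReal.toReal_pos (measure_ball_pos volume (0 : 𝔼) one_pos).ne' measure_ball_lt_top.ne
  have hM : 0 < (maxRieszEnergy N s).toReal :=
    ENNReal.toReal_pos (maxRieszEnergy_pos hN).ne' (maxRieszEnergy_ne_top hN hs hs')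
  have hN' : (0 : ℝ) < N := by exact_mod_cast Nat.pos_of_ne_zero hN
  obtain ⟨R, hR, δ, hδ, hmass⟩ := exists_le_volume_inter_ball (N := N) hN hs hs'
  obtain ⟨K, hK, hpot⟩ := exists_rieszPotential_le_of_volume_le (N := N) hN hs hs'
  have hscale := fun A : Set 𝔼 => toReal_rieszInteraction_self_le (A := A) hN hs hs'
  have hωE : volume (ball (0 : 𝔼) 1) = ENNReal.ofReal (volume.real (ball (0 : 𝔼) 1)) :=
    (ofReal_measureReal measure_ball_lt_top.ne).symm
  set ω := volume.real (ball (0 : 𝔼) 1) with hωdef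
  set M := (maxRieszEnergy N s).toReal with hMdef
  set q := 1 + s / N with hqdef
  have hq : 0 < q := by
    have : -1 < s / N := by rw [lt_div_iff₀ hN']; linarith
    linarith
  set θ := min (min (δ / ω) (κ / ω)) (1 / 2) with hθdef
  have hθ : 0 < θ := by positivity
  have hθ1 : θ ≤ 1 / 2 := min_le_right _ _
  set γ := 1 - (1 - θ) ^ q with hγdef
  have hγ : 0 < γ := sub_pos.2 (Real.rpow_lt_one (by linarith) (by linarith) hq)
  obtain ⟨L, hL, hLpos⟩ : ∃ L : ℝ, L ^ s < M * γ / (8 * ω ^ 2) ∧ 0 < L := by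
    have h := (tendsto_rpow_neg_atTop (neg_pos.2 hs)).eventually_lt_const
      (show (0 : ℝ) < M * γ / (8 * ω ^ 2) by positivity)
    rw [neg_neg] at h
    exact (h.and (eventually_gt_atTop 0)).exists
  obtain ⟨J, hJ⟩ := exists_nat_gt (8 * K * ω / (M * γ))
  have hJ0 : (0 : ℝ) < J := lt_of_le_of_lt (by positivity) hJ
  refine ⟨R + J * L, by positivity, min (M / 2) (M * γ / 2), by positivity,
    fun E hE hvol hen => ?_⟩
  obtain ⟨p, hp⟩ := hmass E hE hvol (by linarith [min_le_left (M / 2) (M * γ / 2)])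
  have hfin : volume E ≠ ∞ := hvol ▸ measure_ball_lt_top.ne
  have hEω : volume.real E = ω := by rw [measureReal_def, hvol]; rfl
  obtain ⟨j, hj, hann⟩ := exists_annulus_volume_le hE hfin p (R := R) hLpos.le
    (by exact_mod_cast hJ0.ne' : J ≠ 0)
  refine ⟨p, ?_⟩
  by_contra! hlt
  have hjJ : ((j : ℝ) + 1) ≤ J := by exact_mod_cast hj
  have hr : R + j * L ≤ R + (j + 1) * L := by linarith
  set A := E ∩ ball p (R + j * L) with hAdef
  set C := E \ ball p (R + (j + 1) * L) with hCdef
  set G := E ∩ (ball p (R + (j + 1) * L) \ ball p (R + j * L)) with hGdef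
  have hA : MeasurableSet A := hE.inter measurableSet_ball
  have hC : MeasurableSet C := hE.diff measurableSet_ball
  have hG : MeasurableSet G := hE.inter (measurableSet_ball.diff measurableSet_ball)
  have hAC : Disjoint A C := by
    rw [Set.disjoint_left]
    intro x hx hx'
    exact hx'.2 (ball_subset_ball hr hx.2)
  have hACG : Disjoint (A ∪ C) G := by
    rw [Set.disjoint_left]
    rintro x (hx | hx) hx'
    · exact hx'.2.2 hx.2
    · exact hx.2 hx'.2.1
  have hunion : (A ∪ C) ∪ G = E := by
    ext x
    have := @ball_subset_ball _ _ p _ _ hr x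
    simp only [hAdef, hCdef, hGdef, mem_union, mem_inter_iff, Set.mem_sdiff]
    tauto
  have hAfin : volume A ≠ ∞ := ne_top_of_le_ne_top hfin (measure_mono inter_subset_left)
  have hCfin : volume C ≠ ∞ := ne_top_of_le_ne_top hfin (measure_mono sdiff_subset)
  have hGfin : volume G ≠ ∞ := ne_top_of_le_ne_top hfin (measure_mono inter_subset_left)
  have hδA : δ ≤ volume.real A := by
    refine hp.trans (measureReal_mono (inter_subset_inter_right _ (ball_subset_ball ?_)) hAfin)
    exact le_add_of_nonneg_right (by positivity)
  have hκC : κ ≤ volume.real C := by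
    refine hlt.le.trans (measureReal_mono (sdiff_subset_sdiff_right (ball_subset_ball ?_)) hCfin)
    gcongr
  have hACω : volume.real A + volume.real C ≤ ω := by
    rw [← measureReal_union hAC hC hAfin hCfin, ← hEω]
    exact measureReal_mono (hunion ▸ subset_union_left) hfin
  have hsplit := rieszInteraction_self_le_of_separated hs hC hG hAC hACG
    (fun x => hunion.symm ▸ hpot E x hE hvol.le) hLpos (fun x hx y hy => by
      have h1 : dist x p < R + j * L := hx.2
      have h2 : R + (j + 1) * L ≤ dist y p := not_lt.1 hy.2
      have h3 := dist_triangle y x p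
      rw [dist_eq_norm y x] at h3
      linarith)
  rw [hunion] at hsplit
  have hIfin : ∀ B : Set 𝔼, B ⊆ E → rieszInteraction s B B ≠ ∞ := fun B hB =>
    ne_top_of_le_ne_top (maxRieszEnergy_ne_top hN hs hs')
      ((rieszInteraction_mono hB hB).trans (le_maxRieszEnergy hE hvol))
  have hAf := hIfin A inter_subset_left
  have hCf := hIfin C sdiff_subset
  have hreal : (rieszInteraction s E E).toReal ≤ (rieszInteraction s A A).toReal +
      (rieszInteraction s C C).toReal + 2 * (L ^ s * volume.real C * volume.real A) +
      2 * (K * volume.real G) := by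
    rw [← ENNReal.ofReal_toReal hAf, ← ENNReal.ofReal_toReal hCf, ← ofReal_measureReal hAfin,
      ← ofReal_measureReal hCfin, ← ofReal_measureReal hGfin] at hsplit
    have h2 : ENNReal.ofReal 2 = 2 := by simp
    simp only [← h2, ← ENNReal.ofReal_mul' measureReal_nonneg,
      ← ENNReal.ofReal_mul zero_le_two] at hsplit
    rw [← ENNReal.ofReal_add (by positivity) (by positivity),
      ← ENNReal.ofReal_add (by positivity) (by positivity),
      ← ENNReal.ofReal_add (by positivity) (by positivity)] at hsplit
    exact ENNReal.toReal_le_of_le_ofReal (by positivity) hsplit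
  have hsA := hscale A hA hAfin
  have hsC := hscale C hC hCfin
  have hpow := rpow_add_rpow_le_of_add_le_one (a := volume.real A / ω) (c := volume.real C / ω)
    hq hθ ((min_le_left _ _).trans ((min_le_left _ _).trans (by gcongr)))
    ((min_le_left _ _).trans ((min_le_right _ _).trans (by gcongr)))
    (by rw [← add_div, div_le_one hω]; exact hACω)
  rw [show 1 + q = 2 + s / N by rw [hqdef]; ring] at hpow
  have hfar : 2 * (L ^ s * volume.real C * volume.real A) ≤ M * γ / 4 := by
    have hA0 : 0 ≤ volume.real A := measureReal_nonneg
    have hC0 : 0 ≤ volume.real C := measureReal_nonneg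
    calc 2 * (L ^ s * volume.real C * volume.real A)
        ≤ 2 * (M * γ / (8 * ω ^ 2) * ω * ω) := by
          gcongr
          · linarith
          · linarith
      _ = M * γ / 4 := by field_simp; norm_num
  have hnear : 2 * (K * volume.real G) ≤ M * γ / 4 := by
    calc 2 * (K * volume.real G) ≤ 2 * (K * (ω / J)) := by gcongr; rwa [hEω] at hann
      _ = (8 * K * ω / (M * γ)) * (M * γ / 4) / J := by field_simp; norm_num
      _ ≤ J * (M * γ / 4) / J := by gcongr
      _ = M * γ / 4 := by field_simp
  have hMpow := mul_le_mul_of_nonneg_left hpow hM.le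
  have hγM : M * (1 - θ) ^ q = M - M * γ := by rw [hγdef]; ring
  linarith [min_le_right (M / 2) (M * γ / 2)]

/-- The reflection across the hyperplane `{x | ⟪v, x⟫ = t}`. -/
noncomputable def hyperplaneReflection (v : 𝔼) (t : ℝ) (x : 𝔼) : 𝔼 :=
  x - (2 * ((⟪v, x⟫ - t) / ‖v‖ ^ 2)) • v

lemma inner_hyperplaneReflection {v : 𝔼} (hv : v ≠ 0) (t : ℝ) (x : 𝔼) :
    ⟪v, hyperplaneReflection v t x⟫ = 2 * t - ⟪v, x⟫ := by
  have hv' : ‖v‖ ≠ 0 := norm_ne_zero_iff.2 hv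
  rw [hyperplaneReflection, inner_sub_right, real_inner_smul_right, real_inner_self_eq_norm_sq]
  field_simp
  ring

lemma hyperplaneReflection_involutive {v : 𝔼} (hv : v ≠ 0) (t : ℝ) :
    Function.Involutive (hyperplaneReflection v t) := by
  intro x
  rw [hyperplaneReflection, inner_hyperplaneReflection hv, hyperplaneReflection, sub_sub,
    ← add_smul, ← mul_add, ← add_div]
  ring_nf
  simp

lemma norm_sub_hyperplaneReflection_sq {v : 𝔼} (hv : v ≠ 0) (t : ℝ) (x y : 𝔼) :
    ‖hyperplaneReflection v t y - x‖ ^ 2 =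
      ‖y - x‖ ^ 2 + 4 * ((t - ⟪v, x⟫) * (t - ⟪v, y⟫)) / ‖v‖ ^ 2 := by
  have hv' : ‖v‖ ≠ 0 := norm_ne_zero_iff.2 hv
  rw [hyperplaneReflection, sub_right_comm, norm_sub_sq_real, real_inner_smul_right, norm_smul,
    mul_pow, Real.norm_eq_abs, sq_abs, inner_sub_left, real_inner_comm v, real_inner_comm v]
  field_simp
  ring

lemma norm_hyperplaneReflection_sq {v : 𝔼} (hv : v ≠ 0) (t : ℝ) (y : 𝔼) :
    ‖hyperplaneReflection v t y‖ ^ 2 = ‖y‖ ^ 2 + 4 * (t * (t - ⟪v, y⟫)) / ‖v‖ ^ 2 := by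
  simpa using norm_sub_hyperplaneReflection_sq hv t 0 y

lemma hyperplaneReflection_isometry {v : 𝔼} (hv : v ≠ 0) (t : ℝ) :
    Isometry (hyperplaneReflection v t) := by
  refine Isometry.of_dist_eq fun x y => ?_
  rw [dist_eq_norm, dist_eq_norm, ← sq_eq_sq₀ (norm_nonneg _) (norm_nonneg _),
    norm_sub_hyperplaneReflection_sq hv, inner_hyperplaneReflection hv, ← norm_neg, neg_sub,
    norm_sub_hyperplaneReflection_sq hv, norm_sub_rev y x]
  ring

lemma measurable_hyperplaneReflection (v : 𝔼) (t : ℝ) :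
    Measurable (hyperplaneReflection v t) := by
  unfold hyperplaneReflection
  fun_prop

lemma measurePreserving_hyperplaneReflection (v : 𝔼) (t : ℝ) :
    MeasurePreserving (hyperplaneReflection v t) := by
  have h : hyperplaneReflection v t =
      (· + (2 * t / ‖v‖ ^ 2) • v) ∘ (ℝ ∙ v)ᗮ.reflection := by
    funext x
    simp only [hyperplaneReflection, Function.comp, Submodule.reflection_orthogonal_apply,
      Submodule.reflection_singleton_apply]
    module
  rw [h]
  exact (measurePreserving_add_right volume _).comp (ℝ ∙ v)ᗮ.reflection.measurePreserving

lemma hyperplaneReflection_div_norm {v : 𝔼} (hv : v ≠ 0) (t : ℝ) :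
    hyperplaneReflection (‖v‖⁻¹ • v) (t / ‖v‖) = hyperplaneReflection v t := by
  have hv' : ‖v‖ ≠ 0 := norm_ne_zero_iff.2 hv
  funext x
  simp only [hyperplaneReflection, norm_smul, norm_inv, norm_norm, inv_mul_cancel₀ hv',
    real_inner_smul_left, smul_smul]
  congr 2
  field_simp

/-- The points below the hyperplane `{x | ⟪v, x⟫ = t}` lying outside `E` but whose mirror image
lies in `E`. -/
def reflectionDefect (E : Set 𝔼) (v : 𝔼) (t : ℝ) : Set 𝔼 :=
  {x | ⟪v, x⟫ < t ∧ x ∉ E ∧ hyperplaneReflection v t x ∈ E}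

/-- The points of `E` below the hyperplane `{x | ⟪v, x⟫ = t}` whose mirror image lies outside
`E`. -/
def reflectionExcess (E : Set 𝔼) (v : 𝔼) (t : ℝ) : Set 𝔼 :=
  {x | ⟪v, x⟫ < t ∧ x ∈ E ∧ hyperplaneReflection v t x ∉ E}

lemma measurableSet_reflectionDefect {E : Set 𝔼} (hE : MeasurableSet E) (v : 𝔼) (t : ℝ) :
    MeasurableSet (reflectionDefect E v t) :=
  (measurableSet_lt (f := fun x => ⟪v, x⟫) (by fun_prop) measurable_const).inter
    (hE.compl.inter (measurable_hyperplaneReflection v t hE))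

lemma measurableSet_reflectionExcess {E : Set 𝔼} (hE : MeasurableSet E) (v : 𝔼) (t : ℝ) :
    MeasurableSet (reflectionExcess E v t) :=
  (measurableSet_lt (f := fun x => ⟪v, x⟫) (by fun_prop) measurable_const).inter
    (hE.inter (measurable_hyperplaneReflection v t hE.compl))

lemma reflectionDefect_div_norm (E : Set 𝔼) {v : 𝔼} (hv : v ≠ 0) (t : ℝ) :
    reflectionDefect E (‖v‖⁻¹ • v) (t / ‖v‖) = reflectionDefect E v t := by
  have hv' : 0 < ‖v‖ := norm_pos_iff.2 hv
  ext x
  simp only [reflectionDefect, hyperplaneReflection_div_norm hv, mem_ofPred_eq,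
    real_inner_smul_left]
  rw [inv_mul_eq_div, div_lt_div_iff_of_pos_right hv']

/-- Polarizing `E` across a hyperplane trades the reflected interaction of the excess and the
defect for the direct one. -/
lemma rieszInteraction_add_le_of_polarization {E : Set 𝔼} (hE : MeasurableSet E)
    (hvol : volume E = volume (ball (0 : 𝔼) 1)) {v : 𝔼} (hv : v ≠ 0) (t : ℝ) :
    rieszInteraction s E E + 2 * rieszInteraction s (reflectionExcess E v t)
        (reflectionDefect E v t) ≤
      maxRieszEnergy N s + 2 * rieszInteraction s (reflectionExcess E v t)
        (hyperplaneReflection v t ⁻¹' reflectionDefect E v t) := by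
  set σ := hyperplaneReflection v t with hσ
  set A := reflectionDefect E v t with hAdef
  set C := reflectionExcess E v t with hCdef
  have hmp : MeasurePreserving σ := measurePreserving_hyperplaneReflection v t
  have hiso : Isometry σ := hyperplaneReflection_isometry hv t
  have hinv : ∀ x, σ (σ x) = x := hyperplaneReflection_involutive hv t
  have hin : ∀ x, ⟪v, σ x⟫ = 2 * t - ⟪v, x⟫ := inner_hyperplaneReflection hv t
  have hA : MeasurableSet A := measurableSet_reflectionDefect hE v t
  have hC : MeasurableSet C := measurableSet_reflectionExcess hE v t
  have hσA : MeasurableSet (σ ⁻¹' A) := hmp.measurable hA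
  set S := E ∩ σ ⁻¹' E with hSdef
  have hS : MeasurableSet S := hE.inter (hmp.measurable hE)
  have hσS : σ ⁻¹' S = S := by
    ext x
    simp only [hSdef, mem_preimage, mem_inter_iff, hinv]
    tauto
  have hSC : Disjoint S C := by
    rw [Set.disjoint_left]
    intro x hx hx'
    exact hx'.2.2 hx.2
  have hXA : Disjoint (S ∪ C) A := by
    rw [Set.disjoint_left]
    rintro x (hx | hx) hx'
    · exact hx'.2.1 hx.1
    · exact hx'.2.1 hx.2.1
  have hXσA : Disjoint (S ∪ C) (σ ⁻¹' A) := by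
    rw [Set.disjoint_left]
    rintro x (hx | hx) hx'
    · exact hx'.2.1 hx.2
    · have h1 := hx.1
      have h2 : ⟪v, σ x⟫ < t := hx'.1
      rw [hin] at h2
      linarith
  have hEeq : (S ∪ C) ∪ σ ⁻¹' A = E := by
    ext x
    have h1 : ⟪v, x⟫ = t → σ x = x := by
      intro h
      simp [hσ, hyperplaneReflection, h]
    have h2 : ⟪v, σ x⟫ < t ↔ t < ⟪v, x⟫ := by
      rw [hin]
      constructor <;> intro h <;> linarith
    simp only [hSdef, hCdef, hAdef, reflectionDefect, reflectionExcess, mem_union, mem_inter_iff,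
      mem_preimage, mem_ofPred_eq, ← hσ, hinv, h2]
    rcases lt_trichotomy ⟪v, x⟫ t with h | h | h
    · simp only [h, h.not_gt]
      tauto
    · simp only [h1 h]
      tauto
    · simp only [h, h.not_gt]
      tauto
  have hP : MeasurableSet ((S ∪ C) ∪ A) := (hS.union hC).union hA
  have hPvol : volume ((S ∪ C) ∪ A) = volume (ball (0 : 𝔼) 1) := by
    rw [measure_union hXA hA, ← hmp.measure_preimage hA.nullMeasurableSet, ← measure_union hXσA hσA,
      hEeq, hvol]
  have h1 : rieszInteraction s S (σ ⁻¹' A) = rieszInteraction s S A := by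
    rw [← rieszInteraction_preimage_of_isometry hmp hiso hS hA, hσS]
  have hEE : rieszInteraction s E E = rieszInteraction s (S ∪ C) (S ∪ C) +
      2 * (rieszInteraction s S A + rieszInteraction s C (σ ⁻¹' A)) + rieszInteraction s A A := by
    conv_lhs => rw [← hEeq]
    rw [rieszInteraction_union_self hσA hXσA, rieszInteraction_preimage_of_isometry hmp hiso hA hA,
      rieszInteraction_union_left hC hSC (σ ⁻¹' A), h1]
  have hPP := rieszInteraction_union_self (s := s) hA hXA
  rw [rieszInteraction_union_left hC hSC A] at hPP
  calc rieszInteraction s E E + 2 * rieszInteraction s C A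
      = rieszInteraction s ((S ∪ C) ∪ A) ((S ∪ C) ∪ A) +
          2 * rieszInteraction s C (σ ⁻¹' A) := by
        rw [hEE, hPP]; ring
    _ ≤ _ := by gcongr; exact le_maxRieszEnergy hP hPvol

lemma exists_rpow_sub_rpow_ge (hs : s < 0) {R τ : ℝ} (hR : 0 < R) (hτ : 0 < τ) :
    ∃ c : ℝ, 0 < c ∧ ∀ a b : ℝ, 0 < a → a ≤ 2 * R → 0 ≤ b → a ^ 2 + 4 * τ ^ 2 ≤ b ^ 2 →
      b ^ s + c ≤ a ^ s := by
  set ρ := √(1 + τ ^ 2 / R ^ 2) with hρ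
  have hρ1 : 1 < ρ := by
    rw [hρ, Real.lt_sqrt zero_le_one]
    have : 0 < τ ^ 2 / R ^ 2 := by positivity
    linarith
  have hρs : ρ ^ s < 1 := Real.rpow_lt_one_of_one_lt_of_neg hρ1 hs
  refine ⟨(2 * R) ^ s * (1 - ρ ^ s), mul_pos (by positivity) (by linarith),
    fun a b ha haR hb hab => ?_⟩
  have hle : ρ * a ≤ b := by
    refine le_of_sq_le_sq ?_ hb
    rw [mul_pow, hρ, Real.sq_sqrt (by positivity)]
    have : τ ^ 2 / R ^ 2 * a ^ 2 ≤ τ ^ 2 / R ^ 2 * (2 * R) ^ 2 := by gcongr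
    have h' : τ ^ 2 / R ^ 2 * (2 * R) ^ 2 = 4 * τ ^ 2 := by field_simp; norm_num
    linarith
  have h1 : b ^ s ≤ ρ ^ s * a ^ s := by
    rw [← Real.mul_rpow (by linarith) ha.le]
    exact Real.rpow_le_rpow_of_nonpos (by positivity) hle hs.le
  have h2 : (2 * R) ^ s ≤ a ^ s := Real.rpow_le_rpow_of_nonpos ha haR hs.le
  nlinarith

/-- Thin slabs have uniformly small volume in a given ball. -/
lemma exists_volume_slab_le (R : ℝ) {ε : ℝ} (hε : 0 < ε) :
    ∃ τ : ℝ, 0 < τ ∧ ∀ (e : 𝔼) (t : ℝ), ‖e‖ = 1 →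
      volume.real (ball (0 : 𝔼) R ∩ {x | t - τ < ⟪e, x⟫ ∧ ⟪e, x⟫ ≤ t}) ≤ ε := by
  obtain ⟨J, hJ⟩ := exists_nat_gt (volume.real (ball (0 : 𝔼) (R + 1)) / ε)
  have hJ0 : (0 : ℝ) < J := lt_of_le_of_lt (by positivity) hJ
  refine ⟨1 / J, by positivity, fun e t he => ?_⟩
  set τ : ℝ := 1 / J with hτ
  have hτ0 : 0 < τ := by positivity
  set T := ball (0 : 𝔼) R ∩ {x | t - τ < ⟪e, x⟫ ∧ ⟪e, x⟫ ≤ t} with hT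
  have hTm : MeasurableSet T := measurableSet_ball.inter
    ((measurableSet_lt (g := fun x => ⟪e, x⟫) measurable_const (by fun_prop)).inter
      (measurableSet_le (f := fun x => ⟪e, x⟫) (by fun_prop) measurable_const))
  set F : ℕ → Set 𝔼 := fun j => (· + (-(j * τ)) • e) ⁻¹' T with hF
  have hFvol : ∀ j, volume.real (F j) = volume.real T := fun j => by
    rw [measureReal_def, measureReal_def, hF,
      (measurePreserving_add_right volume _).measure_preimage hTm.nullMeasurableSet]
  have hFin : ∀ j x, x ∈ F j → t + (j - 1) * τ < ⟪e, x⟫ ∧ ⟪e, x⟫ ≤ t + j * τ := by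
    intro j x hx
    obtain ⟨h1, h2⟩ := hx.2
    simp only [inner_add_right, real_inner_smul_right, real_inner_self_eq_norm_sq, he] at h1 h2
    constructor <;> linarith
  have hdisj : (↑(Finset.range J) : Set ℕ).PairwiseDisjoint F := by
    have key : ∀ i j : ℕ, i < j → Disjoint (F i) (F j) := by
      intro i j hij
      rw [Set.disjoint_left]
      intro x hx hx'
      have h1 := (hFin i x hx).2
      have h2 := (hFin j x hx').1
      have h3 : (i : ℝ) + 1 ≤ j := by exact_mod_cast hij
      nlinarith
    intro i _ j _ hij
    rcases hij.lt_or_gt with h | h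
    · exact key i j h
    · exact (key j i h).symm
  have hsub : ⋃ j ∈ Finset.range J, F j ⊆ ball (0 : 𝔼) (R + 1) := by
    refine iUnion₂_subset fun j hj x hx => ?_
    have h1 : ‖x + (-(j * τ)) • e‖ < R := mem_ball_zero_iff.1 hx.1
    have h2 : ‖(-(j * τ)) • e‖ ≤ 1 := by
      rw [norm_smul, he, mul_one, norm_neg, Real.norm_of_nonneg (by positivity), hτ, mul_one_div,
        div_le_one hJ0]
      exact_mod_cast (Finset.mem_range.1 hj).le
    have h3 := norm_sub_le (x + (-(j * τ)) • e) ((-(j * τ)) • e)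
    rw [add_sub_cancel_right] at h3
    rw [mem_ball_zero_iff]
    linarith
  have hsum : ∑ j ∈ Finset.range J, volume.real (F j) ≤ volume.real (ball (0 : 𝔼) (R + 1)) := by
    have hFT : ∀ j, volume (F j) ≠ ∞ := fun j => by
      rw [hF, (measurePreserving_add_right volume _).measure_preimage hTm.nullMeasurableSet]
      exact ne_top_of_le_ne_top measure_ball_lt_top.ne (measure_mono inter_subset_left)
    rw [← measureReal_biUnion_finset hdisj (fun j _ => hTm.preimage (by fun_prop))
      (fun j _ => hFT j)]
    exact measureReal_mono hsub measure_ball_lt_top.ne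
  simp only [hFvol, Finset.sum_const, Finset.card_range, nsmul_eq_mul] at hsum
  rw [div_lt_iff₀ hε] at hJ
  exact le_of_mul_le_mul_left (hsum.trans hJ.le) hJ0

lemma rieszInteraction_preimage_hyperplaneReflection_add_le (hs : s < 0) {e : 𝔼} (he : ‖e‖ = 1)
    {t τ R c : ℝ} (hτ : 0 < τ)
    (hc : ∀ a b : ℝ, 0 < a → a ≤ 2 * R → 0 ≤ b → a ^ 2 + 4 * τ ^ 2 ≤ b ^ 2 → b ^ s + c ≤ a ^ s)
    (hc0 : 0 ≤ c) {A A' C C' : Set 𝔼} (hA : MeasurableSet A) (hA' : MeasurableSet A')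
    (hC : MeasurableSet C) (hC' : MeasurableSet C') (hAA' : A' ⊆ A) (hCC' : C' ⊆ C)
    (hdisj : Disjoint C A) (hAt : ∀ x ∈ A, ⟪e, x⟫ < t) (hCt : ∀ x ∈ C, ⟪e, x⟫ < t)
    (hAR : ∀ x ∈ A', ‖x‖ < R ∧ ⟪e, x⟫ ≤ t - τ) (hCR : ∀ x ∈ C', ‖x‖ < R ∧ ⟪e, x⟫ ≤ t - τ) :
    rieszInteraction s C (hyperplaneReflection e t ⁻¹' A) +
        ENNReal.ofReal c * volume A' * volume C' ≤
      rieszInteraction s C A := by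
  have he0 : e ≠ 0 := by
    rintro rfl
    simp at he
  set σ := hyperplaneReflection e t with hσ
  have hmp : MeasurePreserving σ := measurePreserving_hyperplaneReflection e t
  have hinv : ∀ x, σ (σ x) = x := hyperplaneReflection_involutive he0 t
  have hsq : ∀ x y, ‖σ y - x‖ ^ 2 = ‖y - x‖ ^ 2 + 4 * ((t - ⟪e, x⟫) * (t - ⟪e, y⟫)) := by
    intro x y
    rw [hσ, norm_sub_hyperplaneReflection_sq he0, he]
    simp
  have hpot : ∀ x, rieszPotential s (σ ⁻¹' A) x =
      ∫⁻ y in A, ENNReal.ofReal (‖σ y - x‖ ^ s) := by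
    intro x
    have hm := hmp.measurable
    rw [← hmp.setLIntegral_comp_preimage hA (by fun_prop)]
    simp only [hinv]
    rfl
  have hpos : ∀ x ∈ C, ∀ y ∈ A, 0 < ‖y - x‖ := by
    intro x hx y hy
    rw [norm_pos_iff, sub_ne_zero]
    rintro rfl
    exact Set.disjoint_left.1 hdisj hx hy
  have hk : ∀ x ∈ C, ∀ y ∈ A, ‖σ y - x‖ ^ s ≤ ‖y - x‖ ^ s := by
    intro x hx y hy
    refine Real.rpow_le_rpow_of_nonpos (hpos x hx y hy) ?_ hs.le
    refine le_of_sq_le_sq ?_ (norm_nonneg _)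
    rw [hsq]
    have := mul_pos (sub_pos.2 (hCt x hx)) (sub_pos.2 (hAt y hy))
    linarith
  have hk' : ∀ x ∈ C', ∀ y ∈ A', ‖σ y - x‖ ^ s + c ≤ ‖y - x‖ ^ s := by
    intro x hx y hy
    obtain ⟨hx1, hx2⟩ := hCR x hx
    obtain ⟨hy1, hy2⟩ := hAR y hy
    refine hc _ _ (hpos x (hCC' hx) y (hAA' hy)) ?_ (norm_nonneg _) ?_
    · linarith [norm_sub_le y x]
    · rw [hsq]
      nlinarith
  have hpoint : ∀ x ∈ C, rieszPotential s (σ ⁻¹' A) x +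
      C'.indicator (fun _ => ENNReal.ofReal c * volume A') x ≤ rieszPotential s A x := by
    intro x hx
    rw [hpot]
    by_cases hx' : x ∈ C'
    · have hind : ENNReal.ofReal c * volume A' =
          ∫⁻ y in A, A'.indicator (fun _ => ENNReal.ofReal c) y := by
        rw [lintegral_indicator hA', setLIntegral_const, Measure.restrict_apply hA',
          inter_eq_left.2 hAA']
      rw [indicator_of_mem hx', hind,
        ← lintegral_add_right _ (measurable_const.indicator hA')]
      refine setLIntegral_mono' hA fun y hy => ?_
      by_cases hy' : y ∈ A'
      · rw [indicator_of_mem hy', ← ENNReal.ofReal_add (by positivity) hc0]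
        exact ENNReal.ofReal_le_ofReal (hk' x hx' y hy')
      · rw [indicator_of_notMem hy', add_zero]
        exact ENNReal.ofReal_le_ofReal (hk x hx y hy)
    · rw [indicator_of_notMem hx', add_zero]
      exact setLIntegral_mono' hA fun y hy => ENNReal.ofReal_le_ofReal (hk x hx y hy)
  have hind : ENNReal.ofReal c * volume A' * volume C' =
      ∫⁻ x in C, C'.indicator (fun _ => ENNReal.ofReal c * volume A') x := by
    rw [lintegral_indicator hC', setLIntegral_const, Measure.restrict_apply hC',
      inter_eq_left.2 hCC']
  rw [hind]
  unfold rieszInteraction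
  rw [← lintegral_add_right _ (measurable_const.indicator hC')]
  exact setLIntegral_mono' hC hpoint

lemma volume_inter_ball_slab_ge {B : Set 𝔼} (hfin : volume B ≠ ∞)
    {e : 𝔼} {t τ R : ℝ} (hB : ∀ x ∈ B, ⟪e, x⟫ < t) :
    volume.real B ≤ volume.real (B ∩ (ball 0 R ∩ {x | ⟪e, x⟫ ≤ t - τ})) +
      volume.real (B \ ball 0 R) +
      volume.real (ball (0 : 𝔼) R ∩ {x | t - τ < ⟪e, x⟫ ∧ ⟪e, x⟫ ≤ t}) := by
  have hsub : B ⊆ (B ∩ (ball 0 R ∩ {x | ⟪e, x⟫ ≤ t - τ}) ∪ (B \ ball 0 R)) ∪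
      (ball (0 : 𝔼) R ∩ {x | t - τ < ⟪e, x⟫ ∧ ⟪e, x⟫ ≤ t}) := by
    intro x hx
    by_cases h1 : x ∈ ball (0 : 𝔼) R
    · rcases le_or_gt ⟪e, x⟫ (t - τ) with h2 | h2
      · exact Or.inl (Or.inl ⟨hx, h1, h2⟩)
      · exact Or.inr ⟨h1, h2, (hB x hx).le⟩
    · exact Or.inl (Or.inr ⟨hx, h1⟩)
  have h1 := ne_top_of_le_ne_top hfin
    (measure_mono (inter_subset_left (s := B) (t := ball 0 R ∩ {x | ⟪e, x⟫ ≤ t - τ})))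
  have h2 := ne_top_of_le_ne_top hfin (measure_mono (sdiff_subset (s := B) (t := ball 0 R)))
  have h3 := ne_top_of_le_ne_top (measure_ball_lt_top (μ := volume) (x := (0 : 𝔼)) (r := R)).ne
    (measure_mono (inter_subset_left (s := ball (0 : 𝔼) R)
      (t := {x | t - τ < ⟪e, x⟫ ∧ ⟪e, x⟫ ≤ t})))
  refine (measureReal_mono hsub (measure_union_ne_top (measure_union_ne_top h1 h2) h3)).trans ?_
  refine (measureReal_union_le _ _).trans ?_
  gcongr
  exact measureReal_union_le _ _

/-- A tight set of nearly maximal energy cannot have both a large defect and a large excess with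
respect to the same hyperplane. -/
lemma exists_reflectionDefect_le_or_reflectionExcess_le (hN : N ≠ 0) (hs : s < 0)
    (hs' : -(N : ℝ) < s) {R ε : ℝ} (hR : 0 < R) (hε : 0 < ε) :
    ∃ η : ℝ, 0 < η ∧ ∀ E : Set 𝔼, MeasurableSet E → volume E = volume (ball (0 : 𝔼) 1) →
      (maxRieszEnergy N s).toReal - η < (rieszInteraction s E E).toReal →
      volume.real (E \ ball 0 R) ≤ ε / 4 → ∀ (e : 𝔼) (t : ℝ), ‖e‖ = 1 → 0 ≤ t →
      volume.real (reflectionDefect E e t) ≤ ε ∨ volume.real (reflectionExcess E e t) ≤ ε := by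
  obtain ⟨τ, hτ, hslab⟩ := exists_volume_slab_le (N := N) R (ε := ε / 4) (by positivity)
  obtain ⟨c, hc0, hc⟩ := exists_rpow_sub_rpow_ge hs hR hτ
  refine ⟨2 * (c * (ε / 2) * (ε / 2)), by positivity, fun E hE hvol hen htight e t he ht => ?_⟩
  by_contra! hcon
  obtain ⟨hAε, hCε⟩ := hcon
  have he0 : e ≠ 0 := by
    rintro rfl
    simp at he
  have hfin : volume E ≠ ∞ := hvol ▸ measure_ball_lt_top.ne
  have hmp := measurePreserving_hyperplaneReflection e t
  set A := reflectionDefect E e t with hAdef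
  set C := reflectionExcess E e t with hCdef
  have hA : MeasurableSet A := measurableSet_reflectionDefect hE e t
  have hC : MeasurableSet C := measurableSet_reflectionExcess hE e t
  have hAfin : volume A ≠ ∞ := by
    refine ne_top_of_le_ne_top hfin ?_
    rw [← hmp.measure_preimage hE.nullMeasurableSet]
    exact measure_mono fun x hx => hx.2.2
  have hCfin : volume C ≠ ∞ := ne_top_of_le_ne_top hfin (measure_mono fun x hx => hx.2.1)
  have hAt : ∀ x ∈ A, ⟪e, x⟫ < t := fun x hx => hx.1
  have hCt : ∀ x ∈ C, ⟪e, x⟫ < t := fun x hx => hx.1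
  have hdisj : Disjoint C A := Set.disjoint_left.2 fun x hx hx' => hx'.2.1 hx.2.1
  set Z := ball (0 : 𝔼) R ∩ {x | ⟪e, x⟫ ≤ t - τ} with hZdef
  have hZ : MeasurableSet Z :=
    measurableSet_ball.inter (measurableSet_le (f := fun x => ⟪e, x⟫) (by fun_prop)
      measurable_const)
  have hZR : ∀ x ∈ Z, ‖x‖ < R ∧ ⟪e, x⟫ ≤ t - τ := fun x hx => ⟨mem_ball_zero_iff.1 hx.1, hx.2⟩
  have hAout : volume.real (A \ ball 0 R) ≤ ε / 4 := by
    refine le_trans ?_ htight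
    have hm : MeasurableSet (E \ ball 0 R) := hE.diff measurableSet_ball
    rw [measureReal_def, measureReal_def, ← hmp.measure_preimage hm.nullMeasurableSet]
    refine ENNReal.toReal_mono ?_ (measure_mono fun x hx => ⟨hx.1.2.2, fun hx' => hx.2 ?_⟩)
    · rw [hmp.measure_preimage hm.nullMeasurableSet]
      exact ne_top_of_le_ne_top hfin (measure_mono sdiff_subset)
    · rw [mem_ball_zero_iff] at hx' ⊢
      refine lt_of_le_of_lt (le_of_sq_le_sq ?_ (norm_nonneg _)) hx'
      rw [norm_hyperplaneReflection_sq he0, he]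
      have := mul_nonneg ht (sub_nonneg.2 (hAt x hx.1).le)
      linarith
  have hCout : volume.real (C \ ball 0 R) ≤ ε / 4 := by
    refine le_trans (measureReal_mono ?_ ?_) htight
    · exact sdiff_subset_sdiff_left fun x hx => hx.2.1
    · exact ne_top_of_le_ne_top hfin (measure_mono sdiff_subset)
  have hA' := volume_inter_ball_slab_ge (R := R) (τ := τ) hAfin hAt
  have hC' := volume_inter_ball_slab_ge (R := R) (τ := τ) hCfin hCt
  have hsl := hslab e t he
  have hkey := rieszInteraction_preimage_hyperplaneReflection_add_le hs he hτ hc hc0.le hA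
    (hA.inter hZ) hC (hC.inter hZ) inter_subset_left inter_subset_left hdisj hAt hCt
    (fun x hx => hZR x hx.2) (fun x hx => hZR x hx.2)
  have hpol := rieszInteraction_add_le_of_polarization (s := s) hE hvol he0 t
  have hM := maxRieszEnergy_ne_top hN hs hs'
  have hσ : rieszInteraction s C (hyperplaneReflection e t ⁻¹' A) ≠ ∞ := by
    obtain ⟨K, hK, hpot⟩ := exists_rieszPotential_le_of_volume_le (N := N) hN hs hs'
    refine ne_top_of_le_ne_top (ENNReal.mul_ne_top ENNReal.ofReal_ne_top hCfin)
      (rieszInteraction_le fun x _ => hpot _ x (hmp.measurable hA) ?_)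
    rw [← hvol]
    refine measure_mono fun x hx => ?_
    have := hx.2.2
    rwa [hyperplaneReflection_involutive he0] at this
  have hfinal : rieszInteraction s E E +
      2 * (ENNReal.ofReal c * volume (A ∩ Z) * volume (C ∩ Z)) ≤ maxRieszEnergy N s := by
    refine ENNReal.le_of_add_le_add_right (ENNReal.mul_ne_top ENNReal.ofNat_ne_top hσ :
      2 * rieszInteraction s C (hyperplaneReflection e t ⁻¹' A) ≠ ∞) ?_
    refine le_trans ?_ hpol
    rw [add_assoc, ← mul_add, add_comm (_ * _ * _)]
    gcongr
  have hreal := ENNReal.toReal_mono hM hfinal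
  have hIE := ne_top_of_le_ne_top hM (le_maxRieszEnergy (s := s) hE hvol)
  rw [ENNReal.toReal_add hIE (ne_top_of_le_ne_top hM (le_add_self.trans hfinal))] at hreal
  simp only [ENNReal.toReal_mul, ENNReal.toReal_ofReal hc0.le, ENNReal.toReal_ofNat,
    ← measureReal_def] at hreal
  have h1 : ε / 2 ≤ volume.real (A ∩ Z) := by linarith
  have h2 : ε / 2 ≤ volume.real (C ∩ Z) := by linarith
  have h3 : c * (ε / 2) * (ε / 2) ≤ c * volume.real (A ∩ Z) * volume.real (C ∩ Z) := by gcongr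
  linarith

/-- Every coordinate hyperplane through the origin bisects `E`. -/
def IsCentered (E : Set 𝔼) : Prop :=
  ∀ i, volume.real (E ∩ {x | x i < 0}) = volume.real E / 2 ∧
    volume.real (E ∩ {x | 0 < x i}) = volume.real E / 2

lemma volume_coord_eq (i : Fin N) (m : ℝ) : volume {x : 𝔼 | x i = m} = 0 := by
  have h := (PiLp.volume_preserving_ofLp (Fin N)).measure_preimage
    (s := {f : Fin N → ℝ | f i = m})
    (measurableSet_eq_fun (measurable_pi_apply i) measurable_const).nullMeasurableSet
  rw [volume_pi, Measure.pi_hyperplane] at h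
  exact h

lemma continuous_volume_inter_halfSpace {E : Set 𝔼} (hfin : volume E ≠ ∞)
    (i : Fin N) : Continuous fun m : ℝ => volume.real (E ∩ {x | x i < m}) := by
  have hlt : ∀ m : ℝ, MeasurableSet {x : 𝔼 | x i < m} := fun m =>
    measurableSet_lt (f := fun x : 𝔼 => x i) (by fun_prop) measurable_const
  have hrw : (fun m : ℝ => volume.real (E ∩ {x | x i < m})) =
      fun m => ∫ x in E, {x : 𝔼 | x i < m}.indicator (fun _ => (1 : ℝ)) x := by
    funext m
    rw [integral_indicator (hlt m), setIntegral_const, measureReal_restrict_apply (hlt m),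
      inter_comm, smul_eq_mul, mul_one]
  rw [hrw, continuous_iff_continuousAt]
  intro m
  have : IsFiniteMeasure (volume.restrict E) := ⟨by simpa using hfin.lt_top⟩
  refine continuousAt_of_dominated (bound := fun _ => 1)
    (Eventually.of_forall fun m' => (measurable_const.indicator (hlt m')).aestronglyMeasurable)
    (Eventually.of_forall fun m' => Eventually.of_forall fun x => ?_) (integrable_const _) ?_
  · refine (norm_indicator_le_norm_self _ _).trans (by simp)
  · have hne : ∀ᵐ x ∂(volume.restrict E), x i ≠ m := by
      refine ae_restrict_of_ae ?_
      rw [ae_iff]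
      simpa using volume_coord_eq i m
    filter_upwards [hne] with x hx
    rcases hx.lt_or_gt with h | h
    · refine (continuousAt_const (y := (1 : ℝ))).congr ?_
      filter_upwards [lt_mem_nhds h] with m' hm'
      rw [indicator_of_mem]
      exact hm'
    · refine (continuousAt_const (y := (0 : ℝ))).congr ?_
      filter_upwards [gt_mem_nhds h] with m' hm'
      rw [indicator_of_notMem]
      exact fun h' => lt_asymm h' hm'

lemma volume_halfSpace_add {E : Set 𝔼} (hE : MeasurableSet E) (hfin : volume E ≠ ∞) (i : Fin N)
    (m : ℝ) :
    volume.real (E ∩ {x | x i < m}) + volume.real (E ∩ {x | m < x i}) = volume.real E := by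
  have hfin' : ∀ S : Set 𝔼, volume (E ∩ S) ≠ ∞ := fun S =>
    ne_top_of_le_ne_top hfin (measure_mono inter_subset_left)
  have hm : MeasurableSet {x : 𝔼 | m < x i} :=
    measurableSet_lt (g := fun x : 𝔼 => x i) measurable_const (by fun_prop)
  rw [← measureReal_union ?_ (hE.inter hm) (hfin' _) (hfin' _)]
  · refine measureReal_congr ?_
    have hne : ∀ᵐ x : 𝔼, x i ≠ m := by
      rw [ae_iff]
      simpa using volume_coord_eq i m
    refine eventuallyEq_set.2 ?_
    filter_upwards [hne] with x hx
    have := hx.lt_or_gt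
    simp only [mem_union, mem_inter_iff, mem_ofPred_eq]
    tauto
  · rw [Set.disjoint_left]
    intro x hx hx'
    have h1 : x i < m := hx.2
    have h2 : m < x i := hx'.2
    exact lt_asymm h1 h2

lemma exists_volume_inter_halfSpace_eq {E : Set 𝔼} (hE : MeasurableSet E) (hfin : volume E ≠ ∞)
    {p : 𝔼} {R : ℝ} (hR : 0 ≤ R) (htight : volume.real (E \ ball p R) ≤ volume.real E / 2)
    (i : Fin N) : ∃ m : ℝ, volume.real (E ∩ {x | x i < m}) = volume.real E / 2 := by
  have hcoord : ∀ x : 𝔼, x ∈ ball p R → |x i - p i| < R := by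
    intro x hx
    rw [mem_ball_iff_norm] at hx
    exact (PiLp.norm_apply_le (x - p) i).trans_lt hx
  have hd : volume (E \ ball p R) ≠ ∞ := ne_top_of_le_ne_top hfin (measure_mono sdiff_subset)
  have h1 : volume.real (E ∩ {x | x i < p i - R}) ≤ volume.real E / 2 := by
    refine (measureReal_mono ?_ hd).trans htight
    intro x hx
    refine ⟨hx.1, fun hx' => ?_⟩
    have h := hcoord x hx'
    have h' : x i < p i - R := hx.2
    rw [abs_lt] at h
    linarith
  have h2 : volume.real E / 2 ≤ volume.real (E ∩ {x | x i < p i + R}) := by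
    have h3 : volume.real (E ∩ {x | p i + R < x i}) ≤ volume.real E / 2 := by
      refine (measureReal_mono ?_ hd).trans htight
      intro x hx
      refine ⟨hx.1, fun hx' => ?_⟩
      have h := hcoord x hx'
      have h' : p i + R < x i := hx.2
      rw [abs_lt] at h
      linarith
    linarith [volume_halfSpace_add hE hfin i (p i + R)]
  obtain ⟨m, -, hm⟩ := intermediate_value_Icc (show p i - R ≤ p i + R by linarith)
    (continuous_volume_inter_halfSpace hfin i).continuousOn ⟨h1, h2⟩
  exact ⟨m, hm⟩

lemma exists_isCentered_preimage_add {E : Set 𝔼} (hE : MeasurableSet E) (hfin : volume E ≠ ∞)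
    {p : 𝔼} {R : ℝ} (hR : 0 ≤ R) (htight : volume.real (E \ ball p R) ≤ volume.real E / 2) :
    ∃ z : 𝔼, IsCentered ((· + z) ⁻¹' E) := by
  choose m hm using exists_volume_inter_halfSpace_eq hE hfin hR htight
  refine ⟨WithLp.toLp 2 m, fun i => ?_⟩
  set z : 𝔼 := WithLp.toLp 2 m with hz
  have hpre : ∀ S : Set 𝔼, MeasurableSet S → volume.real ((· + z) ⁻¹' S) = volume.real S := by
    intro S hS
    rw [measureReal_def, measureReal_def,
      (measurePreserving_add_right volume z).measure_preimage hS.nullMeasurableSet]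
  have h1 : (· + z) ⁻¹' E ∩ {x | x i < 0} = (· + z) ⁻¹' (E ∩ {x | x i < m i}) := by
    ext x
    simp [hz]
  have h2 : (· + z) ⁻¹' E ∩ {x | 0 < x i} = (· + z) ⁻¹' (E ∩ {x | m i < x i}) := by
    ext x
    simp [hz]
  have hlt : MeasurableSet {x : 𝔼 | x i < m i} :=
    measurableSet_lt (f := fun x : 𝔼 => x i) (by fun_prop) measurable_const
  have hgt : MeasurableSet {x : 𝔼 | m i < x i} :=
    measurableSet_lt (g := fun x : 𝔼 => x i) measurable_const (by fun_prop)
  rw [h1, h2, hpre _ (hE.inter hlt), hpre _ (hE.inter hgt), hpre _ hE]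
  exact ⟨hm i, by linarith [hm i, volume_halfSpace_add hE hfin i (m i)]⟩

lemma IsCentered.sdiff_ball_subset {E : Set 𝔼} (hc : IsCentered E) (hfin : volume E ≠ ∞)
    {p : 𝔼} {R : ℝ} (hR : 0 ≤ R) (htight : volume.real (E \ ball p R) < volume.real E / 2) :
    E \ ball 0 (R + N * R) ⊆ E \ ball p R := by
  have hd : volume (E \ ball p R) ≠ ∞ := ne_top_of_le_ne_top hfin (measure_mono sdiff_subset)
  have hcoord : ∀ x : 𝔼, x ∈ ball p R → ∀ i, |x i - p i| < R := by
    intro x hx i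
    rw [mem_ball_iff_norm] at hx
    exact (PiLp.norm_apply_le (x - p) i).trans_lt hx
  have hp : ∀ i, |p i| ≤ R := by
    intro i
    by_contra! hlt
    rcases lt_abs.1 hlt with h | h
    · refine absurd (hc i).1.ge (not_le.2 ((measureReal_mono ?_ hd).trans_lt htight))
      intro x hx
      refine ⟨hx.1, fun hx' => ?_⟩
      have h1 := (abs_lt.1 (hcoord x hx' i)).1
      have h2 : x i < 0 := hx.2
      linarith
    · refine absurd (hc i).2.ge (not_le.2 ((measureReal_mono ?_ hd).trans_lt htight))
      intro x hx
      refine ⟨hx.1, fun hx' => ?_⟩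
      have h1 := (abs_lt.1 (hcoord x hx' i)).2
      have h2 : 0 < x i := hx.2
      linarith
  have hpn : ‖p‖ ≤ N * R := by
    refine le_of_sq_le_sq ?_ (by positivity)
    rw [EuclideanSpace.real_norm_sq_eq]
    calc ∑ i, p i ^ 2 ≤ ∑ _i : Fin N, R ^ 2 :=
          Finset.sum_le_sum fun i _ => sq_le_sq' (abs_le.1 (hp i)).1 (abs_le.1 (hp i)).2
      _ = N * R ^ 2 := by simp
      _ ≤ N ^ 2 * R ^ 2 := by gcongr; exact_mod_cast Nat.le_self_pow two_ne_zero N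
      _ = (N * R) ^ 2 := by ring
  refine sdiff_subset_sdiff_right fun x hx => ?_
  rw [mem_ball_iff_norm] at hx
  rw [mem_ball_zero_iff]
  linarith [norm_le_norm_sub_add x p]

lemma exists_volume_sdiff_ball_le_of_isCentered (hN : N ≠ 0) (hs : s < 0) (hs' : -(N : ℝ) < s)
    {κ : ℝ} (hκ : 0 < κ) :
    ∃ R : ℝ, 0 < R ∧ ∃ η : ℝ, 0 < η ∧ ∀ E : Set 𝔼, MeasurableSet E →
      volume E = volume (ball (0 : 𝔼) 1) → IsCentered E →
      (maxRieszEnergy N s).toReal - η < (rieszInteraction s E E).toReal →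
      volume.real (E \ ball 0 R) ≤ κ := by
  have hω : 0 < volume.real (ball (0 : 𝔼) 1) :=
    ENNReal.toReal_pos (measure_ball_pos volume (0 : 𝔼) one_pos).ne' measure_ball_lt_top.ne
  obtain ⟨R, hR, η, hη, h⟩ := exists_volume_sdiff_ball_le (N := N) hN hs hs'
    (κ := min κ (volume.real (ball (0 : 𝔼) 1) / 4)) (by positivity)
  refine ⟨R + N * R, by positivity, η, hη, fun E hE hvol hc hen => ?_⟩
  obtain ⟨p, hp⟩ := h E hE hvol hen
  have hfin : volume E ≠ ∞ := hvol ▸ measure_ball_lt_top.ne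
  have hEω : volume.real E = volume.real (ball (0 : 𝔼) 1) := by
    rw [measureReal_def, hvol]; rfl
  have hlt : volume.real (E \ ball p R) < volume.real E / 2 := by
    rw [hEω]
    linarith [hp.trans (min_le_right _ _)]
  exact (measureReal_mono (hc.sdiff_ball_subset hfin hR.le hlt)
    (ne_top_of_le_ne_top hfin (measure_mono sdiff_subset))).trans (hp.trans (min_le_left _ _))

lemma volume_reflectionDefect_add {E : Set 𝔼} (hE : MeasurableSet E) (hfin : volume E ≠ ∞) {v : 𝔼}
    (hv : v ≠ 0) (t : ℝ) :
    volume.real (reflectionDefect E v t) + volume.real (E ∩ {x | ⟪v, x⟫ < t}) =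
      volume.real (reflectionExcess E v t) + volume.real (E ∩ {x | t < ⟪v, x⟫}) := by
  set σ := hyperplaneReflection v t with hσ
  have hmp : MeasurePreserving σ := measurePreserving_hyperplaneReflection v t
  have hinv : ∀ x, σ (σ x) = x := hyperplaneReflection_involutive hv t
  have hin : ∀ x, ⟪v, σ x⟫ = 2 * t - ⟪v, x⟫ := inner_hyperplaneReflection hv t
  have hpre : ∀ S : Set 𝔼, MeasurableSet S → volume.real (σ ⁻¹' S) = volume.real S := by
    intro S hS
    rw [measureReal_def, measureReal_def, hmp.measure_preimage hS.nullMeasurableSet]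
  have hlt : MeasurableSet {x : 𝔼 | ⟪v, x⟫ < t} :=
    measurableSet_lt (f := fun x => ⟪v, x⟫) (by fun_prop) measurable_const
  have hS : MeasurableSet ((E ∩ σ ⁻¹' E) ∩ {x | ⟪v, x⟫ < t}) :=
    (hE.inter (hmp.measurable hE)).inter hlt
  have hsub : ∀ {S : Set 𝔼}, S ⊆ E → volume S ≠ ∞ := fun h =>
    ne_top_of_le_ne_top hfin (measure_mono h)
  have h1 : volume.real (E ∩ {x | ⟪v, x⟫ < t}) = volume.real (reflectionExcess E v t) +
      volume.real ((E ∩ σ ⁻¹' E) ∩ {x | ⟪v, x⟫ < t}) := by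
    rw [← measureReal_union ?_ hS (hsub fun x hx => hx.2.1) (hsub fun x hx => hx.1.1)]
    · congr 1
      ext x
      simp only [reflectionExcess, mem_union, mem_inter_iff, mem_ofPred_eq, mem_preimage, ← hσ]
      tauto
    · rw [Set.disjoint_left]
      exact fun x hx hx' => hx.2.2 hx'.1.2
  have h2 : volume.real (E ∩ {x | t < ⟪v, x⟫}) = volume.real (reflectionDefect E v t) +
      volume.real ((E ∩ σ ⁻¹' E) ∩ {x | ⟪v, x⟫ < t}) := by
    rw [← hpre _ (measurableSet_reflectionDefect hE v t), ← hpre _ hS,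
      ← measureReal_union ?_ (hmp.measurable hS) (hsub fun x hx => ?_) (hsub fun x hx => ?_)]
    · congr 1
      ext x
      have : 2 * t - ⟪v, x⟫ < t ↔ t < ⟪v, x⟫ := by
        constructor <;> intro h <;> linarith
      simp only [reflectionDefect, mem_union, mem_inter_iff, mem_ofPred_eq, mem_preimage, ← hσ,
        hinv, hin, this]
      tauto
    · rw [Set.disjoint_left]
      exact fun x hx hx' => hx.2.1 hx'.1.1
    · have := hx.2.2
      rwa [← hσ, hinv] at this
    · have h := hx.1.2
      rwa [mem_preimage, hinv] at h
  linarith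

/-- If the excess and defect with respect to all coordinate hyperplanes are small, then `E` is
almost symmetric under reversing any set of coordinates. -/
lemma exists_measurePreserving_coord_neg {E : Set 𝔼} (hE : MeasurableSet E) (hfin : volume E ≠ ∞)
    {ε : ℝ} (hD : ∀ i, volume.real (reflectionDefect E (EuclideanSpace.single i 1) 0) ≤ ε)
    (hX : ∀ i, volume.real (reflectionExcess E (EuclideanSpace.single i 1) 0) ≤ ε)
    (T : Finset (Fin N)) :
    ∃ g : 𝔼 → 𝔼, MeasurePreserving g ∧ (∀ x i, g x i = if i ∈ T then -x i else x i) ∧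
      volume.real (E \ g ⁻¹' E) ≤ T.card * (2 * ε) := by
  induction T using Finset.induction_on with
  | empty => exact ⟨id, MeasurePreserving.id _, by simp, by simp⟩
  | insert i T hi ih =>
    obtain ⟨g, hg, hgc, hgE⟩ := ih
    set e : 𝔼 := EuclideanSpace.single i 1 with he
    have he0 : e ≠ 0 := by
      intro h
      have : ‖e‖ = 1 := by simp [he]
      simp [h] at this
    have hin : ∀ x : 𝔼, ⟪e, x⟫ = x i := fun x => by simp [he, EuclideanSpace.inner_single_left]
    set σ := hyperplaneReflection e 0 with hσ
    have hmp : MeasurePreserving σ := measurePreserving_hyperplaneReflection e 0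
    have hinv : ∀ x, σ (σ x) = x := hyperplaneReflection_involutive he0 0
    have hσc : ∀ x j, σ x j = if j = i then -x j else x j := by
      intro x j
      have hn : ‖e‖ = 1 := by simp [he]
      simp only [hσ, hyperplaneReflection, hin, hn, PiLp.sub_apply, PiLp.smul_apply, smul_eq_mul]
      rw [he, PiLp.single_apply]
      split_ifs with h
      · subst h; ring
      · ring
    refine ⟨σ ∘ g, hmp.comp hg, fun x j => ?_, ?_⟩
    · rw [Function.comp_apply, hσc, hgc]
      by_cases h : j = i
      · subst h
        simp [hi]
      · simp [h]
    · have hEσ : MeasurableSet (E \ σ ⁻¹' E) := hE.diff (hmp.measurable hE)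
      have hσE : volume.real (E \ σ ⁻¹' E) ≤ 2 * ε := by
        have hsub : E \ σ ⁻¹' E ⊆ reflectionExcess E e 0 ∪ σ ⁻¹' reflectionDefect E e 0 := by
          intro x hx
          rcases lt_trichotomy ⟪e, x⟫ 0 with h | h | h
          · exact Or.inl ⟨h, hx.1, hx.2⟩
          · refine absurd ?_ hx.2
            rw [mem_preimage, hσ, hyperplaneReflection, h]
            simpa using hx.1
          · refine Or.inr ⟨?_, hx.2, ?_⟩
            · rw [inner_hyperplaneReflection he0]
              linarith
            · rw [← hσ, hinv]
              exact hx.1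
        have hA := measurableSet_reflectionDefect hE e 0
        have hXf : volume (reflectionExcess E e 0) ≠ ∞ :=
          ne_top_of_le_ne_top hfin (measure_mono fun x hx => hx.2.1)
        have hAf : volume (σ ⁻¹' reflectionDefect E e 0) ≠ ∞ := by
          refine ne_top_of_le_ne_top hfin (measure_mono fun x hx => ?_)
          have := hx.2.2
          rwa [← hσ, hinv] at this
        have hAv : volume.real (σ ⁻¹' reflectionDefect E e 0) =
            volume.real (reflectionDefect E e 0) := by
          rw [measureReal_def, measureReal_def, hmp.measure_preimage hA.nullMeasurableSet]
        refine (measureReal_mono hsub (measure_union_ne_top hXf hAf)).trans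
          ((measureReal_union_le _ _).trans ?_)
        rw [hAv]
        linarith [hD i, hX i]
      have hsub : E \ (σ ∘ g) ⁻¹' E ⊆ (E \ g ⁻¹' E) ∪ g ⁻¹' (E \ σ ⁻¹' E) := by
        intro x hx
        by_cases h : g x ∈ E
        · exact Or.inr ⟨h, hx.2⟩
        · exact Or.inl ⟨hx.1, h⟩
      have h1 : volume (E \ g ⁻¹' E) ≠ ∞ := ne_top_of_le_ne_top hfin (measure_mono sdiff_subset)
      have h2 : volume (g ⁻¹' (E \ σ ⁻¹' E)) ≠ ∞ := by
        rw [hg.measure_preimage hEσ.nullMeasurableSet]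
        exact ne_top_of_le_ne_top hfin (measure_mono sdiff_subset)
      have h3 : volume.real (g ⁻¹' (E \ σ ⁻¹' E)) = volume.real (E \ σ ⁻¹' E) := by
        rw [measureReal_def, measureReal_def, hg.measure_preimage hEσ.nullMeasurableSet]
      refine (measureReal_mono hsub (measure_union_ne_top h1 h2)).trans
        ((measureReal_union_le _ _).trans ?_)
      rw [h3, Finset.card_insert_of_notMem hi]
      push_cast
      linarith

lemma volume_inter_halfSpace_le {E : Set 𝔼} (hE : MeasurableSet E) (hfin : volume E ≠ ∞)
    (e : 𝔼) {t : ℝ} (ht : 0 ≤ t) :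
    volume.real (E ∩ {x | t < ⟪e, x⟫}) ≤
      volume.real (E ∩ {x | ⟪e, x⟫ < t}) + volume.real (E \ Neg.neg ⁻¹' E) := by
  have hneg : MeasurePreserving (Neg.neg : 𝔼 → 𝔼) := Measure.measurePreserving_neg volume
  have hlt : MeasurableSet {x : 𝔼 | ⟪e, x⟫ < t} :=
    measurableSet_lt (f := fun x => ⟪e, x⟫) (by fun_prop) measurable_const
  have hB : MeasurableSet (E ∩ {x | ⟪e, x⟫ < t}) := hE.inter hlt
  have hsub : E ∩ {x | t < ⟪e, x⟫} ⊆
      Neg.neg ⁻¹' (E ∩ {x | ⟪e, x⟫ < t}) ∪ (E \ Neg.neg ⁻¹' E) := by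
    intro x hx
    by_cases h : -x ∈ E
    · refine Or.inl ⟨h, ?_⟩
      have h1 : t < ⟪e, x⟫ := hx.2
      change ⟪e, -x⟫ < t
      rw [inner_neg_right]
      linarith
    · exact Or.inr ⟨hx.1, h⟩
  have h1 : volume (Neg.neg ⁻¹' (E ∩ {x | ⟪e, x⟫ < t})) ≠ ∞ := by
    rw [hneg.measure_preimage hB.nullMeasurableSet]
    exact ne_top_of_le_ne_top hfin (measure_mono inter_subset_left)
  have h2 : volume (E \ Neg.neg ⁻¹' E) ≠ ∞ := ne_top_of_le_ne_top hfin (measure_mono sdiff_subset)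
  refine (measureReal_mono hsub (measure_union_ne_top h1 h2)).trans
    ((measureReal_union_le _ _).trans_eq ?_)
  simp only [measureReal_def, hneg.measure_preimage hB.nullMeasurableSet]

/-- The defect of a centered set of nearly maximal energy with respect to hyperplanes leaving the
origin below them is uniformly small. -/
lemma exists_reflectionDefect_le (hN : N ≠ 0) (hs : s < 0) (hs' : -(N : ℝ) < s) {κ : ℝ}
    (hκ : 0 < κ) :
    ∃ η : ℝ, 0 < η ∧ ∀ E : Set 𝔼, MeasurableSet E →
      volume E = volume (ball (0 : 𝔼) 1) → IsCentered E →
      (maxRieszEnergy N s).toReal - η < (rieszInteraction s E E).toReal →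
      ∀ (v : 𝔼) (t : ℝ), v ≠ 0 → 0 ≤ t → volume.real (reflectionDefect E v t) ≤ κ := by
  set ε := κ / (2 * N + 1) with hε
  have hε0 : 0 < ε := by positivity
  obtain ⟨R, hR, η₁, hη₁, htight⟩ := exists_volume_sdiff_ball_le_of_isCentered (N := N) hN hs hs'
    (κ := ε / 4) (by positivity)
  obtain ⟨η₂, hη₂, hpol⟩ := exists_reflectionDefect_le_or_reflectionExcess_le hN hs hs' hR hε0
  refine ⟨min η₁ η₂, lt_min hη₁ hη₂, fun E hE hvol hc hen => ?_⟩
  have hfin : volume E ≠ ∞ := hvol ▸ measure_ball_lt_top.ne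
  have hmin := hpol E hE hvol (by linarith [min_le_right η₁ η₂])
    (htight E hE hvol hc (by linarith [min_le_left η₁ η₂]))
  have hcoord : ∀ i : Fin N, volume.real (reflectionDefect E (EuclideanSpace.single i 1) 0) ≤ ε ∧
      volume.real (reflectionExcess E (EuclideanSpace.single i 1) 0) ≤ ε := by
    intro i
    have he : ‖(EuclideanSpace.single i 1 : 𝔼)‖ = 1 := by simp
    have he0 : (EuclideanSpace.single i 1 : 𝔼) ≠ 0 := by
      intro h
      simp [h] at he
    have hbal := volume_reflectionDefect_add hE hfin he0 0
    simp only [EuclideanSpace.inner_single_left, map_one, one_mul] at hbal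
    rw [(hc i).1, (hc i).2] at hbal
    rcases hmin _ 0 he le_rfl with h | h
    · exact ⟨h, by linarith⟩
    · exact ⟨by linarith, h⟩
  obtain ⟨g, -, hgc, hg⟩ := exists_measurePreserving_coord_neg hE hfin (fun i => (hcoord i).1)
    (fun i => (hcoord i).2) Finset.univ
  have hgneg : g = Neg.neg := by
    funext x
    ext i
    simp [hgc]
  rw [hgneg, Finset.card_univ, Fintype.card_fin] at hg
  intro v t hv ht
  have hv' : 0 < ‖v‖ := norm_pos_iff.2 hv
  rw [← reflectionDefect_div_norm E hv]
  have he : ‖‖v‖⁻¹ • v‖ = 1 := by rw [norm_smul, norm_inv, norm_norm, inv_mul_cancel₀ hv'.ne']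
  have he0 : ‖v‖⁻¹ • v ≠ 0 := smul_ne_zero (inv_ne_zero hv'.ne') hv
  have ht' : 0 ≤ t / ‖v‖ := by positivity
  have hκε : (2 * N + 1) * ε = κ := mul_div_cancel₀ _ (by positivity)
  have hNε : 0 ≤ N * ε := by positivity
  rcases hmin _ _ he ht' with h | h
  · linarith
  · have h1 := volume_reflectionDefect_add hE hfin he0 (t / ‖v‖)
    have h2 := volume_inter_halfSpace_le hE hfin (‖v‖⁻¹ • v) ht'
    linarith

/-- If all defects of `E` are at most `κ`, then few segments along a given direction lead from a
bounded part of `E` outside the unit ball into the part of the unit ball missed by `E`. -/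
lemma lintegral_volume_segment_le {E : Set 𝔼} (hE : MeasurableSet E) {κ : ℝ≥0∞}
    (hdef : ∀ (v : 𝔼) (t : ℝ), v ≠ 0 → 0 ≤ t → volume (reflectionDefect E v t) ≤ κ)
    {R r : ℝ} (hr : 0 < r) {v : 𝔼} (hv : v ∈ ball (0 : 𝔼) (2 * R) \ ball 0 r) :
    ∫⁻ x in (E \ ball 0 1) ∩ ball 0 R, ∫⁻ u in Icc (1 : ℝ) 2,
        (ball 0 1 \ E).indicator (fun _ => (1 : ℝ≥0∞)) (x - u • v) ≤
      ENNReal.ofReal (2 / r ^ 2) * ENNReal.ofReal (2 * R ^ 2) * κ := by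
  set X := (E \ ball (0 : 𝔼) 1) ∩ ball 0 R with hX
  set Y := ball (0 : 𝔼) 1 \ E with hY
  have hXm : MeasurableSet X := (hE.diff measurableSet_ball).inter measurableSet_ball
  have hYm : MeasurableSet Y := measurableSet_ball.diff hE
  have hvr : r ≤ ‖v‖ := by simpa using hv.2
  have hvR : ‖v‖ < 2 * R := by simpa using hv.1
  have hv0 : 0 < ‖v‖ := hr.trans_le hvr
  have hvne : v ≠ 0 := norm_pos_iff.1 hv0
  have hinv : ∀ t x, hyperplaneReflection v t (hyperplaneReflection v t x) = x := fun t =>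
    hyperplaneReflection_involutive hvne t
  have hR : 0 < R := by linarith
  have hmeas : Measurable fun p : 𝔼 × ℝ =>
      Y.indicator (fun _ => (1 : ℝ≥0∞)) (hyperplaneReflection v p.2 p.1) := by
    refine (measurable_const.indicator hYm).comp ?_
    unfold hyperplaneReflection
    fun_prop
  have hslice : ∀ x ∈ X, ∫⁻ u in Icc (1 : ℝ) 2, Y.indicator (fun _ => (1 : ℝ≥0∞)) (x - u • v) ≤
      ENNReal.ofReal (2 / r ^ 2) * ∫⁻ t in Ioo (0 : ℝ) (2 * R ^ 2),
        Y.indicator (fun _ => (1 : ℝ≥0∞)) (hyperplaneReflection v t x) := by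
    intro x hx
    have hm1 : Measurable fun u : ℝ => x - u • v := by fun_prop
    have hm2 : Measurable fun t : ℝ => hyperplaneReflection v t x := by
      unfold hyperplaneReflection
      fun_prop
    have h1 : ∫⁻ u in Icc (1 : ℝ) 2, Y.indicator (fun _ => (1 : ℝ≥0∞)) (x - u • v) =
        volume ((fun u : ℝ => x - u • v) ⁻¹' Y ∩ Icc 1 2) := by
      rw [← Measure.restrict_apply (hm1 hYm), ← lintegral_indicator_one (hm1 hYm)]
      rfl
    have h2 : ∫⁻ t in Ioo (0 : ℝ) (2 * R ^ 2),
        Y.indicator (fun _ => (1 : ℝ≥0∞)) (hyperplaneReflection v t x) =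
        volume ((fun t : ℝ => hyperplaneReflection v t x) ⁻¹' Y ∩ Ioo 0 (2 * R ^ 2)) := by
      rw [← Measure.restrict_apply (hm2 hYm), ← lintegral_indicator_one (hm2 hYm)]
      rfl
    rw [h1, h2]
    set T := (fun t : ℝ => hyperplaneReflection v t x) ⁻¹' Y ∩ Ioo 0 (2 * R ^ 2) with hT
    set a : ℝ := -(‖v‖ ^ 2 / 2) with ha
    have ha0 : a ≠ 0 := by
      have : 0 < ‖v‖ ^ 2 / 2 := by positivity
      linarith
    have hsub : (fun u : ℝ => x - u • v) ⁻¹' Y ∩ Icc 1 2 ⊆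
        (a * ·) ⁻¹' ((· + ⟪v, x⟫) ⁻¹' T) := by
      rintro u ⟨hu, hu1, hu2⟩
      have href : hyperplaneReflection v (a * u + ⟪v, x⟫) x = x - u • v := by
        rw [hyperplaneReflection]
        congr 2
        rw [ha]
        field_simp
        ring
      have hd : a * u < 0 := by
        have : 0 < ‖v‖ ^ 2 / 2 * u := by positivity
        rw [ha, neg_mul]
        linarith
      refine ⟨?_, ?_, ?_⟩
      · change hyperplaneReflection v (a * u + ⟪v, x⟫) x ∈ Y
        rw [href]
        exact hu
      · have h3 := norm_hyperplaneReflection_sq hvne (a * u + ⟪v, x⟫) x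
        have h4 : ‖hyperplaneReflection v (a * u + ⟪v, x⟫) x‖ < 1 := by
          rw [href]
          simpa using hu.1
        have h5 : 1 ≤ ‖x‖ := by simpa using hx.1.2
        by_contra! hneg
        rw [add_sub_cancel_right] at h3
        have h6 : 0 ≤ 4 * ((a * u + ⟪v, x⟫) * (a * u)) / ‖v‖ ^ 2 := by
          have := mul_nonneg_of_nonpos_of_nonpos hneg hd.le
          positivity
        have h7 := norm_nonneg (hyperplaneReflection v (a * u + ⟪v, x⟫) x)
        nlinarith
      · have h3 := real_inner_le_norm v x
        have h4 : ‖x‖ < R := by simpa using hx.2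
        have h5 : ‖v‖ * ‖x‖ ≤ 2 * R * R := by gcongr
        change a * u + ⟪v, x⟫ < 2 * R ^ 2
        linarith
    refine (measure_mono hsub).trans ?_
    rw [Real.volume_preimage_mul_left ha0, measure_preimage_add_right]
    gcongr
    rw [ha, inv_neg, abs_neg, abs_of_nonneg (by positivity), inv_div]
    gcongr
  calc ∫⁻ x in X, ∫⁻ u in Icc (1 : ℝ) 2, Y.indicator (fun _ => (1 : ℝ≥0∞)) (x - u • v)
      ≤ ∫⁻ x in X, ENNReal.ofReal (2 / r ^ 2) * ∫⁻ t in Ioo (0 : ℝ) (2 * R ^ 2),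
          Y.indicator (fun _ => (1 : ℝ≥0∞)) (hyperplaneReflection v t x) :=
        setLIntegral_mono' hXm hslice
    _ = ENNReal.ofReal (2 / r ^ 2) * ∫⁻ t in Ioo (0 : ℝ) (2 * R ^ 2), ∫⁻ x in X,
          Y.indicator (fun _ => (1 : ℝ≥0∞)) (hyperplaneReflection v t x) := by
        rw [lintegral_const_mul' _ _ ENNReal.ofReal_ne_top,
          lintegral_lintegral_swap hmeas.aemeasurable]
    _ ≤ ENNReal.ofReal (2 / r ^ 2) * ∫⁻ _ in Ioo (0 : ℝ) (2 * R ^ 2), κ := by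
        gcongr ENNReal.ofReal (2 / r ^ 2) * ?_
        refine setLIntegral_mono' measurableSet_Ioo fun t ht => ?_
        have hmp := measurePreserving_hyperplaneReflection v t
        have hpre := hmp.measurable hYm
        have h1 : ∫⁻ x in X, Y.indicator (fun _ => (1 : ℝ≥0∞)) (hyperplaneReflection v t x) =
            volume (hyperplaneReflection v t ⁻¹' Y ∩ X) := by
          rw [← Measure.restrict_apply hpre, ← lintegral_indicator_one hpre]
          rfl
        rw [h1]
        refine le_trans ?_ (hdef v t hvne ht.1.le)
        rw [← hmp.measure_preimage (measurableSet_reflectionDefect hE v t).nullMeasurableSet]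
        refine measure_mono fun x hx => ⟨?_, hx.1.2, ?_⟩
        · have h3 := norm_hyperplaneReflection_sq hvne t x
          have h4 : ‖hyperplaneReflection v t x‖ < 1 := by simpa using hx.1.1
          have h5 : 1 ≤ ‖x‖ := by simpa using hx.2.1.2
          rw [inner_hyperplaneReflection hvne]
          by_contra! hneg
          have h6 : 0 ≤ 4 * (t * (t - ⟪v, x⟫)) / ‖v‖ ^ 2 := by
            have := mul_nonneg ht.1.le (show 0 ≤ t - ⟪v, x⟫ by linarith)
            positivity
          have h7 := norm_nonneg (hyperplaneReflection v t x)
          nlinarith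
        · rw [hinv]
          exact hx.2.1.1
    _ = _ := by
        rw [setLIntegral_const, Real.volume_Ioo, sub_zero]
        ring

lemma le_volume_preimage_sub_smul {Y : Set 𝔼} (hY : MeasurableSet Y) (hYB : Y ⊆ ball 0 1)
    {R r : ℝ} (hR : 1 ≤ R) {x : 𝔼} (hx : ‖x‖ < R) {u : ℝ} (hu : u ∈ Icc (1 : ℝ) 2) :
    ENNReal.ofReal (2 ^ N)⁻¹ * (volume Y - volume (ball (0 : 𝔼) (2 * r))) ≤
      volume ((fun v : 𝔼 => x - u • v) ⁻¹' Y ∩ (ball (0 : 𝔼) (2 * R) \ ball 0 r)) := by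
  have hu0 : 0 < u := by linarith [hu.1]
  have hm : MeasurableSet (Y \ ball x (2 * r)) := hY.diff measurableSet_ball
  have hsub : (u • ·) ⁻¹' ((fun y : 𝔼 => x - y) ⁻¹' (Y \ ball x (2 * r))) ⊆
      (fun v : 𝔼 => x - u • v) ⁻¹' Y ∩ (ball (0 : 𝔼) (2 * R) \ ball 0 r) := by
    intro v hv
    have h1 : x - u • v ∈ Y := hv.1
    have h2 : ‖x - u • v‖ < 1 := by simpa using hYB h1
    have h3 : 2 * r ≤ ‖u • v‖ := by simpa [dist_eq_norm] using hv.2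
    have h4 := norm_sub_le x (x - u • v)
    rw [sub_sub_cancel] at h4
    rw [norm_smul, Real.norm_of_nonneg hu0.le] at h3 h4
    have h5 := norm_nonneg v
    refine ⟨h1, ?_, fun h => ?_⟩
    · rw [mem_ball_zero_iff]
      nlinarith [hu.1]
    · rw [mem_ball_zero_iff] at h
      nlinarith [hu.2]
  refine le_trans ?_ (measure_mono hsub)
  rw [Measure.addHaar_preimage_smul _ hu0.ne',
    (Measure.measurePreserving_sub_left volume x).measure_preimage hm.nullMeasurableSet,
    finrank_euclideanSpace_fin]
  gcongr ENNReal.ofReal ?_ * ?_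
  · rw [abs_of_nonneg (by positivity)]
    have := hu.2
    gcongr
  · have hb : volume (ball x (2 * r)) = volume (ball (0 : 𝔼) (2 * r)) :=
      Measure.addHaar_ball_center volume x (2 * r)
    rw [← hb]
    exact le_measure_sdiff

lemma volume_mul_volume_le {E : Set 𝔼} (hE : MeasurableSet E) {κ : ℝ≥0∞}
    (hdef : ∀ (v : 𝔼) (t : ℝ), v ≠ 0 → 0 ≤ t → volume (reflectionDefect E v t) ≤ κ)
    {R r : ℝ} (hR : 1 ≤ R) (hr : 0 < r) :
    ENNReal.ofReal (2 ^ N)⁻¹ * (volume (ball 0 1 \ E) - volume (ball (0 : 𝔼) (2 * r))) *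
        volume ((E \ ball 0 1) ∩ ball 0 R) ≤
      ENNReal.ofReal (2 / r ^ 2) * ENNReal.ofReal (2 * R ^ 2) * κ *
        volume (ball (0 : 𝔼) (2 * R)) := by
  set X := (E \ ball (0 : 𝔼) 1) ∩ ball 0 R with hX
  set Y := ball (0 : 𝔼) 1 \ E with hY
  set V := ball (0 : 𝔼) (2 * R) \ ball 0 r with hV
  have hXm : MeasurableSet X := (hE.diff measurableSet_ball).inter measurableSet_ball
  have hYm : MeasurableSet Y := measurableSet_ball.diff hE
  have hVm : MeasurableSet V := measurableSet_ball.diff measurableSet_ball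
  have hind : Measurable (Y.indicator fun _ => (1 : ℝ≥0∞)) := measurable_const.indicator hYm
  have hmeas : Measurable fun p : (𝔼 × 𝔼) × ℝ =>
      Y.indicator (fun _ => (1 : ℝ≥0∞)) (p.1.1 - p.2 • p.1.2) := hind.comp (by fun_prop)
  have hmeas' : ∀ x : 𝔼, Measurable fun p : 𝔼 × ℝ =>
      Y.indicator (fun _ => (1 : ℝ≥0∞)) (x - p.2 • p.1) := fun x => hind.comp (by fun_prop)
  have hvol : volume (Icc (1 : ℝ) 2) = 1 := by
    rw [Real.volume_Icc]
    norm_num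
  calc ENNReal.ofReal (2 ^ N)⁻¹ * (volume Y - volume (ball (0 : 𝔼) (2 * r))) * volume X
      = ∫⁻ _ in X, ∫⁻ _ in Icc (1 : ℝ) 2,
          ENNReal.ofReal (2 ^ N)⁻¹ * (volume Y - volume (ball (0 : 𝔼) (2 * r))) := by
        simp only [setLIntegral_const, hvol, mul_one]
    _ ≤ ∫⁻ x in X, ∫⁻ u in Icc (1 : ℝ) 2, ∫⁻ v in V,
          Y.indicator (fun _ => (1 : ℝ≥0∞)) (x - u • v) := by
        refine setLIntegral_mono' hXm fun x hx => setLIntegral_mono' measurableSet_Icc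
          fun u hu => ?_
        have hm1 : Measurable fun v : 𝔼 => x - u • v := by fun_prop
        have h1 : ∫⁻ v in V, Y.indicator (fun _ => (1 : ℝ≥0∞)) (x - u • v) =
            volume ((fun v : 𝔼 => x - u • v) ⁻¹' Y ∩ V) := by
          rw [← Measure.restrict_apply (hm1 hYm), ← lintegral_indicator_one (hm1 hYm)]
          rfl
        rw [h1]
        exact le_volume_preimage_sub_smul hYm sdiff_subset hR (by simpa using hx.2) hu
    _ = ∫⁻ x in X, ∫⁻ v in V, ∫⁻ u in Icc (1 : ℝ) 2,
          Y.indicator (fun _ => (1 : ℝ≥0∞)) (x - u • v) := by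
        refine lintegral_congr fun x => ?_
        exact (lintegral_lintegral_swap (hmeas' x).aemeasurable).symm
    _ = ∫⁻ v in V, ∫⁻ x in X, ∫⁻ u in Icc (1 : ℝ) 2,
          Y.indicator (fun _ => (1 : ℝ≥0∞)) (x - u • v) :=
        lintegral_lintegral_swap (Measurable.lintegral_prod_right' hmeas).aemeasurable
    _ ≤ ∫⁻ _ in V, ENNReal.ofReal (2 / r ^ 2) * ENNReal.ofReal (2 * R ^ 2) * κ :=
        setLIntegral_mono' hVm fun v hv => lintegral_volume_segment_le hE hdef hr hv
    _ ≤ _ := by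
        rw [setLIntegral_const]
        gcongr
        exact sdiff_subset

lemma volume_real_ball_le (hN : N ≠ 0) {ρ : ℝ} (hρ : 0 < ρ) (hρ1 : ρ ≤ 1) :
    volume.real (ball (0 : 𝔼) ρ) ≤ ρ * volume.real (ball (0 : 𝔼) 1) := by
  have h : volume (ball (0 : 𝔼) ρ) =
      ENNReal.ofReal (ρ ^ finrank ℝ 𝔼) * volume (ball (0 : 𝔼) 1) :=
    Measure.addHaar_ball_of_pos volume 0 hρ
  rw [finrank_euclideanSpace_fin] at h
  rw [measureReal_def, h, ENNReal.toReal_mul, ENNReal.toReal_ofReal (by positivity),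
    ← measureReal_def]
  gcongr
  exact pow_le_of_le_one hρ.le hρ1 hN

lemma rieszInteraction_preimage_add_right {A B : Set 𝔼} (hA : MeasurableSet A)
    (hB : MeasurableSet B) (z : 𝔼) :
    rieszInteraction s ((· + z) ⁻¹' A) ((· + z) ⁻¹' B) = rieszInteraction s A B :=
  rieszInteraction_preimage_of_isometry (measurePreserving_add_right volume z)
    (isometry_add_right z) hA hB

lemma volume_real_ball_symmDiff_lt {E : Set 𝔼} (hE : MeasurableSet E)
    (hvol : volume E = volume (ball (0 : 𝔼) 1)) {μ κ : ℝ} (hμ : 0 < μ) {R r : ℝ} (hR : 1 ≤ R)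
    (hr : 0 < r)
    (hsmall : volume.real (ball (0 : 𝔼) (2 * r)) ≤ μ / 8)
    (htight : volume.real (E \ ball (0 : 𝔼) R) ≤ μ / 8)
    (hκ : 2 / r ^ 2 * (2 * R ^ 2) * κ * volume.real (ball (0 : 𝔼) (2 * R)) <
      (2 ^ N)⁻¹ * (μ / 4) * (μ / 4))
    (hκ0 : 0 ≤ κ)
    (hdef : ∀ (v : 𝔼) (t : ℝ), v ≠ 0 → 0 ≤ t → volume (reflectionDefect E v t) ≤
      ENNReal.ofReal κ) :
    volume.real (ball (0 : 𝔼) 1 ∆ E) < μ := by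
  by_contra! hcon
  have hEfin : volume E ≠ ∞ := by rw [hvol]; exact measure_ball_lt_top.ne
  have hBfin : volume (ball (0 : 𝔼) 1) ≠ ∞ := measure_ball_lt_top.ne
  have heq : volume.real (ball (0 : 𝔼) 1 \ E) = volume.real (E \ ball (0 : 𝔼) 1) := by
    have h1 := measureReal_sdiff_add_inter (μ := volume) (s := E) (t := ball (0 : 𝔼) 1)
      measurableSet_ball hEfin
    have h2 := measureReal_sdiff_add_inter (μ := volume) (s := ball (0 : 𝔼) 1) (t := E) hE hBfin
    rw [inter_comm] at h2
    have h3 : volume.real E = volume.real (ball (0 : 𝔼) 1) := by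
      rw [measureReal_def, hvol, measureReal_def]
    linarith
  have hsd : volume.real (ball (0 : 𝔼) 1 ∆ E) ≤
      volume.real (ball (0 : 𝔼) 1 \ E) + volume.real (E \ ball (0 : 𝔼) 1) :=
    measureReal_union_le _ _
  have hfinX : volume ((E \ ball (0 : 𝔼) 1) ∩ ball 0 R) ≠ ∞ :=
    measure_ne_top_of_subset (inter_subset_left.trans sdiff_subset) hEfin
  have hX : μ / 4 ≤ volume.real ((E \ ball (0 : 𝔼) 1) ∩ ball 0 R) := by
    have h1 : volume.real (E \ ball (0 : 𝔼) 1) ≤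
        volume.real ((E \ ball (0 : 𝔼) 1) ∩ ball 0 R) + volume.real (E \ ball (0 : 𝔼) R) := by
      refine (measureReal_mono ?_ ?_).trans (measureReal_union_le _ _)
      · rintro x ⟨h, h'⟩
        by_cases hx : x ∈ ball (0 : 𝔼) R
        · exact Or.inl ⟨⟨h, h'⟩, hx⟩
        · exact Or.inr ⟨h, hx⟩
      · exact measure_union_ne_top hfinX (measure_ne_top_of_subset sdiff_subset hEfin)
    linarith
  have hmain := volume_mul_volume_le hE hdef hR hr
  have hball : volume (ball (0 : 𝔼) (2 * R)) ≠ ∞ := measure_ball_lt_top.ne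
  have hY : ENNReal.ofReal (μ / 4) ≤
      volume (ball (0 : 𝔼) 1 \ E) - volume (ball (0 : 𝔼) (2 * r)) := by
    have hf : volume (ball (0 : 𝔼) 1 \ E) ≠ ∞ := measure_ne_top_of_subset sdiff_subset hBfin
    rw [← ENNReal.ofReal_toReal hf, ← ENNReal.ofReal_toReal
      (measure_ball_lt_top : volume (ball (0 : 𝔼) (2 * r)) < ∞).ne,
      ← ENNReal.ofReal_sub _ ENNReal.toReal_nonneg]
    refine ENNReal.ofReal_le_ofReal ?_
    rw [← measureReal_def, ← measureReal_def]
    linarith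
  have hX' : ENNReal.ofReal (μ / 4) ≤ volume ((E \ ball (0 : 𝔼) 1) ∩ ball 0 R) := by
    rw [← ENNReal.ofReal_toReal hfinX]
    exact ENNReal.ofReal_le_ofReal hX
  have h : ENNReal.ofReal (2 ^ N)⁻¹ * ENNReal.ofReal (μ / 4) * ENNReal.ofReal (μ / 4) ≤
      ENNReal.ofReal (2 / r ^ 2) * ENNReal.ofReal (2 * R ^ 2) * ENNReal.ofReal κ *
        volume (ball (0 : 𝔼) (2 * R)) :=
    le_trans (by gcongr) hmain
  rw [← ENNReal.ofReal_toReal hball, ← measureReal_def, ← ENNReal.ofReal_mul (by positivity),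
    ← ENNReal.ofReal_mul (by positivity), ← ENNReal.ofReal_mul (by positivity),
    ← ENNReal.ofReal_mul (by positivity), ← ENNReal.ofReal_mul (by positivity),
    ENNReal.ofReal_le_ofReal_iff (by positivity)] at h
  linarith

lemma exists_volume_ball_symmDiff_lt (hN : N ≠ 0) (hs : s < 0) (hs' : -(N : ℝ) < s)
    {μ : ℝ} (hμ : 0 < μ) :
    ∃ η : ℝ, 0 < η ∧ ∀ E : Set 𝔼, MeasurableSet E →
      volume E = volume (ball (0 : 𝔼) 1) →
      (maxRieszEnergy N s).toReal - η < (rieszInteraction s E E).toReal →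
      ∃ x, volume.real (ball x 1 ∆ E) < μ := by
  have : Nonempty (Fin N) := ⟨⟨0, Nat.pos_of_ne_zero hN⟩⟩
  set ω := volume.real (ball (0 : 𝔼) 1) with hω
  have hω0 : 0 < ω :=
    ENNReal.toReal_pos (measure_ball_pos volume 0 one_pos).ne' measure_ball_lt_top.ne
  obtain ⟨R₁, hR₁, η₁, hη₁, h₁⟩ := exists_volume_sdiff_ball_le hN hs hs' (half_pos hω0)
  obtain ⟨R₂, hR₂, η₂, hη₂, h₂⟩ :=
    exists_volume_sdiff_ball_le_of_isCentered hN hs hs' (κ := μ / 8) (by positivity)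
  obtain ⟨r, hr, hr4, hrμ⟩ : ∃ r : ℝ, 0 < r ∧ r ≤ 1 / 4 ∧ r ≤ μ / (16 * ω) :=
    ⟨min (1 / 4) (μ / (16 * ω)), by positivity, min_le_left _ _, min_le_right _ _⟩
  have hsmall : volume.real (ball (0 : 𝔼) (2 * r)) ≤ μ / 8 := by
    refine (volume_real_ball_le hN (by positivity) (by linarith)).trans ?_
    rw [le_div_iff₀ (by positivity)] at hrμ
    rw [← hω]
    linarith
  set R := max R₂ 1
  have hR : 1 ≤ R := le_max_right _ _
  obtain ⟨κ, hκ, hκlt⟩ : ∃ κ : ℝ, 0 < κ ∧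
      2 / r ^ 2 * (2 * R ^ 2) * κ * volume.real (ball (0 : 𝔼) (2 * R)) <
        (2 ^ N)⁻¹ * (μ / 4) * (μ / 4) := by
    set b := volume.real (ball (0 : 𝔼) (2 * R))
    have hc : 0 < 2 / r ^ 2 * (2 * R ^ 2) * b + 1 := by positivity
    refine ⟨(2 ^ N)⁻¹ * (μ / 4) * (μ / 4) / (2 / r ^ 2 * (2 * R ^ 2) * b + 1), by positivity, ?_⟩
    have hd : 0 < (2 ^ N : ℝ)⁻¹ * (μ / 4) * (μ / 4) := by positivity
    generalize (2 ^ N : ℝ)⁻¹ * (μ / 4) * (μ / 4) = d at hd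
    generalize 2 / r ^ 2 * (2 * R ^ 2) = c at hc
    rw [mul_right_comm, mul_div_assoc', div_lt_iff₀ hc]
    linarith
  obtain ⟨η₃, hη₃, h₃⟩ := exists_reflectionDefect_le hN hs hs' hκ
  refine ⟨min η₁ (min η₂ η₃), by positivity, fun E hE hvol hopt => ?_⟩
  have hm1 := min_le_left η₁ (min η₂ η₃)
  have hm2 := (min_le_right η₁ (min η₂ η₃)).trans (min_le_left _ _)
  have hm3 := (min_le_right η₁ (min η₂ η₃)).trans (min_le_right _ _)
  have hEfin : volume E ≠ ∞ := by rw [hvol]; exact measure_ball_lt_top.ne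
  obtain ⟨p, hp⟩ := h₁ E hE hvol (by linarith)
  obtain ⟨z, hz⟩ := exists_isCentered_preimage_add hE hEfin hR₁.le (p := p)
    (by rwa [show volume.real E = ω by rw [measureReal_def, hvol, hω, measureReal_def]])
  have hmp := measurePreserving_add_right (volume : Measure 𝔼) z
  set F := (· + z) ⁻¹' E with hF
  have hFm : MeasurableSet F := hmp.measurable hE
  have hFvol : volume F = volume (ball (0 : 𝔼) 1) := by
    rw [hF, hmp.measure_preimage hE.nullMeasurableSet, hvol]
  have hFI : rieszInteraction s F F = rieszInteraction s E E :=
    rieszInteraction_preimage_add_right hE hE z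
  rw [← hFI] at hopt
  have key : volume.real (ball (0 : 𝔼) 1 ∆ F) < μ := by
    refine volume_real_ball_symmDiff_lt hFm hFvol hμ hR hr hsmall ?_ hκlt hκ.le
      fun v t hv ht => ?_
    · refine (measureReal_mono (sdiff_subset_sdiff_right (ball_subset_ball (le_max_left _ _)))
        ?_).trans (h₂ F hFm hFvol hz (by linarith))
      exact measure_ne_top_of_subset sdiff_subset (hFvol ▸ measure_ball_lt_top.ne)
    · have h := h₃ F hFm hFvol hz (by linarith) v t hv ht
      have hfin : volume (reflectionDefect F v t) ≠ ∞ := by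
        refine measure_ne_top_of_subset (s := hyperplaneReflection v t ⁻¹' F) (fun x hx => hx.2.2) ?_
        rw [(measurePreserving_hyperplaneReflection v t).measure_preimage hFm.nullMeasurableSet,
          hFvol]
        exact measure_ball_lt_top.ne
      exact (ENNReal.le_ofReal_iff_toReal_le hfin hκ.le).2 h
  refine ⟨z, ?_⟩
  have hpre : ball (0 : 𝔼) 1 ∆ F = (· + z) ⁻¹' (ball z 1 ∆ E) := by
    ext x
    simp [mem_symmDiff, F, dist_eq_norm]
  rwa [hpre, measureReal_def, hmp.measure_preimage
    (measurableSet_ball.symmDiff hE).nullMeasurableSet] at key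

lemma exists_lt_toReal_rieszInteraction (hN : N ≠ 0) (hs : s < 0) (hs' : -(N : ℝ) < s) {η : ℝ}
    (hη : 0 < η) :
    ∃ E : Set 𝔼, MeasurableSet E ∧ volume E = volume (ball (0 : 𝔼) 1) ∧
      (maxRieszEnergy N s).toReal - η < (rieszInteraction s E E).toReal := by
  have hM := maxRieszEnergy_ne_top hN hs hs'
  obtain ⟨E, hE, h⟩ : ∃ E : Set 𝔼, (MeasurableSet E ∧ volume E = volume (ball (0 : 𝔼) 1)) ∧
      maxRieszEnergy N s - ENNReal.ofReal η < rieszInteraction s E E := by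
    by_contra! hcon
    exact (ENNReal.sub_lt_self hM (maxRieszEnergy_pos hN).ne' (by simpa)).not_ge (iSup₂_le hcon)
  refine ⟨E, hE.1, hE.2, ?_⟩
  calc (maxRieszEnergy N s).toReal - η
      = (maxRieszEnergy N s).toReal - (ENNReal.ofReal η).toReal := by
        rw [ENNReal.toReal_ofReal hη.le]
    _ ≤ (maxRieszEnergy N s - ENNReal.ofReal η).toReal :=
        ENNReal.le_toReal_sub ENNReal.ofReal_ne_top
    _ < (rieszInteraction s E E).toReal :=
        ENNReal.toReal_strict_mono (ne_top_of_le_ne_top hM (le_maxRieszEnergy hE.1 hE.2)) h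

lemma rieszInteraction_self_le_add {E F : Set 𝔼} (hE : MeasurableSet E) (hF : MeasurableSet F)
    {K : ℝ≥0∞} (hEK : ∀ x, rieszPotential s E x ≤ K) (hFK : ∀ x, rieszPotential s F x ≤ K) :
    rieszInteraction s E E ≤ rieszInteraction s F F + 3 * K * volume (E \ F) := by
  calc rieszInteraction s E E ≤ rieszInteraction s (F ∪ E \ F) (F ∪ E \ F) := by
        have : E ⊆ F ∪ E \ F := by simp
        exact rieszInteraction_mono this this
    _ = rieszInteraction s F F + 2 * rieszInteraction s (E \ F) F +
          rieszInteraction s (E \ F) (E \ F) := by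
        rw [rieszInteraction_union_self (hE.diff hF) disjoint_sdiff_self_right,
          rieszInteraction_comm F (E \ F)]
    _ ≤ rieszInteraction s F F + 2 * (K * volume (E \ F)) + K * volume (E \ F) := by
        gcongr
        · exact rieszInteraction_le fun x _ => hFK x
        · exact rieszInteraction_le fun x _ => (rieszPotential_mono sdiff_subset x).trans (hEK x)
    _ = _ := by ring

lemma maxRieszEnergy_eq (hN : N ≠ 0) (hs : s < 0) (hs' : -(N : ℝ) < s) :
    maxRieszEnergy N s = rieszInteraction s (ball (0 : 𝔼) 1) (ball 0 1) := by
  have hM := maxRieszEnergy_ne_top hN hs hs'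
  have hle := le_maxRieszEnergy (s := s) (measurableSet_ball (x := (0 : 𝔼)) (ε := 1)) rfl
  have hI := ne_top_of_le_ne_top hM hle
  refine le_antisymm ?_ hle
  rw [← ENNReal.toReal_le_toReal hM hI]
  obtain ⟨K, hK, hpot⟩ := exists_rieszPotential_le_of_volume_le (N := N) hN hs hs'
  refine le_of_forall_pos_le_add fun ε hε => ?_
  obtain ⟨η, hη, h⟩ := exists_volume_ball_symmDiff_lt hN hs hs' (μ := ε / (6 * K)) (by positivity)
  obtain ⟨E, hE, hvol, hopt⟩ :=
    exists_lt_toReal_rieszInteraction hN hs hs' (lt_min hη (half_pos hε))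
  obtain ⟨x, hx⟩ := h E hE hvol (by linarith [min_le_left η (ε / 2)])
  have hball : rieszInteraction s (ball x 1) (ball x 1) =
      rieszInteraction s (ball (0 : 𝔼) 1) (ball 0 1) := by
    rw [← rieszInteraction_preimage_add_right measurableSet_ball measurableSet_ball x]
    simp
  have hsub : E \ ball x 1 ⊆ ball x 1 ∆ E := le_sup_right
  have hEfin : volume E ≠ ∞ := by rw [hvol]; exact measure_ball_lt_top.ne
  have hfin : volume (E \ ball x 1) ≠ ∞ := measure_ne_top_of_subset sdiff_subset hEfin
  have hvx : volume.real (E \ ball x 1) ≤ ε / (6 * K) :=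
    (measureReal_mono hsub (measure_union_ne_top (measure_ne_top_of_subset sdiff_subset
      measure_ball_lt_top.ne) hfin)).trans hx.le
  have h1 := rieszInteraction_self_le_add (s := s) hE (measurableSet_ball (x := x) (ε := 1))
    (fun y => hpot E y hE hvol.le)
    (fun y => hpot _ y measurableSet_ball (Measure.addHaar_ball_center volume x 1).le)
  have h3 : 3 * ENNReal.ofReal K * volume (E \ ball x 1) ≠ ∞ := by finiteness
  rw [hball] at h1
  have h2 := ENNReal.toReal_mono (ENNReal.add_ne_top.2 ⟨hI, h3⟩) h1
  rw [ENNReal.toReal_add hI h3, ENNReal.toReal_mul, ENNReal.toReal_mul,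
    ENNReal.toReal_ofReal hK.le, ← measureReal_def, ENNReal.toReal_ofNat] at h2
  rw [le_div_iff₀ (by positivity)] at hvx
  linarith [min_le_right η (ε / 2)]

lemma rieszEnergy_eq_toReal {α : ℝ} (hN : N ≠ 0) (hα : 0 < α) (hα' : α < N) {E : Set 𝔼}
    (hE : MeasurableSet E) (hfin : volume E ≠ ∞) :
    rieszEnergy N α E = (rieszInteraction (α - N) E E).toReal := by
  obtain ⟨K, hK, h⟩ := exists_rieszPotential_le (N := N) (s := α - N) hN (by linarith)
    (by linarith)
  have hpot : ∀ x, rieszPotential (α - N) E x < ∞ := fun x =>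
    (h E x hE).trans_lt (ENNReal.add_lt_top.2 ⟨hK.lt_top, hfin.lt_top⟩)
  have hinner : ∀ x : 𝔼, ∫ y in E, ‖y - x‖ ^ (α - (N : ℝ)) =
      (rieszPotential (α - N) E x).toReal := fun x =>
    integral_eq_lintegral_of_nonneg_ae (ae_of_all _ fun y => by positivity)
      (Measurable.pow_const (by fun_prop) _).aestronglyMeasurable
  rw [rieszEnergy, rieszInteraction]
  simp_rw [hinner]
  exact integral_toReal (measurable_rieszPotential E).aemeasurable (ae_of_all _ hpot)

end

theorem deficit_lower_bound_of_asymmetry (N : ℕ) (hN : 2 ≤ N) (α : ℝ) (hα₁ : 1 < α)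
    (hα₂ : α < N) (μ : ℝ) (hμ : 0 < μ) :
    ∃ η : ℝ, 0 < η ∧ ∀ E : Set (EuclideanSpace ℝ (Fin N)), MeasurableSet E →
      volume E = volume (ball (0 : EuclideanSpace ℝ (Fin N)) 1) →
      μ ≤ asymmetry N E → η ≤ deficit N α E := by
  have hN0 : N ≠ 0 := by lia
  have hs : α - (N : ℝ) < 0 := by linarith
  have hs' : -(N : ℝ) < α - N := by linarith
  obtain ⟨η, hη, h⟩ := exists_volume_ball_symmDiff_lt hN0 hs hs' hμ
  refine ⟨η, hη, fun E hE hvol hasym => ?_⟩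
  by_contra! hlt
  have hBfin : volume (ball (0 : EuclideanSpace ℝ (Fin N)) 1) ≠ ⊤ := measure_ball_lt_top.ne
  rw [deficit, rieszEnergy_eq_toReal hN0 (by linarith) hα₂ measurableSet_ball hBfin,
    rieszEnergy_eq_toReal hN0 (by linarith) hα₂ hE (hvol ▸ hBfin), ← maxRieszEnergy_eq hN0 hs hs']
    at hlt
  obtain ⟨x, hx⟩ := h E hE hvol (by linarith)
  have hle : asymmetry N E ≤ volume.real (ball x 1 ∆ E) :=
    ciInf_le ⟨0, by rintro _ ⟨y, rfl⟩; exact ENNReal.toReal_nonneg⟩ x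
  linarith
end

section
/- Let N ≥ 2 and 1 < α < N. There exists a constant ξ = ξ(α, N) > 0 such that every measurable set E ⊆ ℝ^N with |E| = ω_N and δ(E) ≥ 2(ω_N − ξ) satisfies D(E) > (ω_N²/5^N)·(1 − 2^{−(N−α)}). -/
open MeasureTheory Metric
open scoped symmDiff

noncomputable def omegaN (N : ℕ) : ℝ :=
  (volume (ball (0 : EuclideanSpace ℝ (Fin N)) 1)).toReal

open Filter Topology

section RieszPotential

variable {N : ℕ} {α : ℝ}

lemma locallyIntegrable_riesz_kernel (hN : 1 ≤ N) (hα : 0 < α) :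
    LocallyIntegrable (fun z : EuclideanSpace ℝ (Fin N) => ‖z‖ ^ (α - (N : ℝ))) := by
  refine locallyIntegrable_of_norm_le_rpow (C := 1) (α := N - α) (by simpa using hN)
    (by simpa using hα) (Eventually.of_forall fun z => ?_) ?_
  · rw [Real.norm_of_nonneg (by positivity), one_mul, neg_sub]
  · exact (by fun_prop : Measurable _).aestronglyMeasurable

lemma integrableOn_riesz_kernel_ball (hN : 1 ≤ N) (hα : 0 < α)
    (x : EuclideanSpace ℝ (Fin N)) (r : ℝ) :
    IntegrableOn (fun y => ‖y - x‖ ^ (α - (N : ℝ))) (ball x r) := by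
  have h : IntegrableOn (fun z : EuclideanSpace ℝ (Fin N) => ‖z‖ ^ (α - (N : ℝ))) (ball 0 r) :=
    ((locallyIntegrable_riesz_kernel hN hα).integrableOn_isCompact
      (isCompact_closedBall 0 r)).mono_set ball_subset_closedBall
  have e := (measurePreserving_sub_right (volume : Measure (EuclideanSpace ℝ (Fin N))) x)
  have := (e.integrableOn_comp_preimage (MeasurableEquiv.subRight x).measurableEmbedding).2 h
  convert! this using 1
  ext y; simp [dist_eq_norm]

lemma setIntegral_riesz_kernel_ball (x : EuclideanSpace ℝ (Fin N)) (r : ℝ) :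
    ∫ y in ball x r, ‖y - x‖ ^ (α - (N : ℝ))
      = ∫ z in ball (0 : EuclideanSpace ℝ (Fin N)) r, ‖z‖ ^ (α - (N : ℝ)) := by
  have e := (measurePreserving_sub_right (volume : Measure (EuclideanSpace ℝ (Fin N))) x)
  have h := e.setIntegral_preimage_emb (MeasurableEquiv.subRight x).measurableEmbedding
    (fun z => ‖z‖ ^ (α - (N : ℝ))) (ball 0 r)
  rw [← h]
  congr 2
  ext y; simp [dist_eq_norm]

lemma tendsto_setIntegral_riesz_kernel_ball (hN : 1 ≤ N) (hα : 0 < α) :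
    Tendsto (fun r : ℝ => ∫ z in ball (0 : EuclideanSpace ℝ (Fin N)) r, ‖z‖ ^ (α - (N : ℝ)))
      (𝓝[>] 0) (𝓝 0) := by
  have : Nontrivial (EuclideanSpace ℝ (Fin N)) :=
    Module.nontrivial_of_finrank_pos (R := ℝ) (by simpa using Nat.succ_le_iff.1 hN)
  have h1 := integrableOn_riesz_kernel_ball hN hα (0 : EuclideanSpace ℝ (Fin N)) 1
  simp only [sub_zero] at h1
  have h2 : Tendsto (fun r : ℝ => volume (ball (0 : EuclideanSpace ℝ (Fin N)) r))
      (𝓝[>] 0) (𝓝 0) := by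
    have : Tendsto (fun r : ℝ => ENNReal.ofReal (r ^ N) *
        volume (ball (0 : EuclideanSpace ℝ (Fin N)) 1)) (𝓝[>] 0) (𝓝 0) := by
      have h0 : Tendsto (fun r : ℝ => ENNReal.ofReal (r ^ N)) (𝓝[>] 0) (𝓝 0) := by
        have : Tendsto (fun r : ℝ => ENNReal.ofReal (r ^ N)) (𝓝 0)
            (𝓝 (ENNReal.ofReal ((0 : ℝ) ^ N))) :=
          (ENNReal.continuous_ofReal.comp (continuous_pow N)).tendsto 0
        rw [zero_pow (by lia), ENNReal.ofReal_zero] at this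
        exact this.mono_left nhdsWithin_le_nhds
      simpa using ENNReal.Tendsto.mul_const h0 (Or.inr measure_ball_lt_top.ne)
    refine this.congr' ?_
    filter_upwards [self_mem_nhdsWithin] with r hr
    rw [Measure.addHaar_ball_of_pos _ _ hr]
    simp
  have h3 := h1.integrable.tendsto_setIntegral_nhds_zero (l := 𝓝[>] (0 : ℝ))
    (s := fun r => ball (0 : EuclideanSpace ℝ (Fin N)) r)
    (tendsto_of_tendsto_of_tendsto_of_le_of_le tendsto_const_nhds h2 (fun _ => zero_le)
      fun _ => Measure.restrict_apply_le _ _)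
  refine h3.congr' ?_
  filter_upwards [Ioo_mem_nhdsGT (zero_lt_one' ℝ)] with r hr
  rw [Measure.restrict_restrict measurableSet_ball,
    Set.inter_eq_left.2 (ball_subset_ball hr.2.le)]

lemma riesz_potential_le (hN : 1 ≤ N) (hα : 0 < α) (hα' : α < N)
    {E : Set (EuclideanSpace ℝ (Fin N))} (hfin : volume E ≠ ⊤)
    (x : EuclideanSpace ℝ (Fin N)) {r R : ℝ} (hr : 0 < r) (hR : 0 < R) :
    ∫ y in E, ‖y - x‖ ^ (α - (N : ℝ)) ≤
      (∫ z in ball (0 : EuclideanSpace ℝ (Fin N)) r, ‖z‖ ^ (α - (N : ℝ)))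
        + r ^ (α - (N : ℝ)) * volume.real (E ∩ ball x R)
        + R ^ (α - (N : ℝ)) * volume.real E := by
  set p := α - (N : ℝ)
  have hp : p ≤ 0 := by simp only [p]; linarith
  set k : EuclideanSpace ℝ (Fin N) → ℝ := fun y => ‖y - x‖ ^ p
  have hk : ∀ y, 0 ≤ k y := fun y => by positivity
  have hint := integrableOn_riesz_kernel_ball hN hα x r
  have i1 : Integrable ((ball x r).indicator k) (volume.restrict E) :=
    ((integrable_indicator_iff measurableSet_ball).2 hint).mono_measure Measure.restrict_le_self
  have i2 : Integrable ((ball x R).indicator fun _ => r ^ p) (volume.restrict E) :=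
    (integrableOn_const hfin).indicator measurableSet_ball
  have i3 : Integrable (fun _ : EuclideanSpace ℝ (Fin N) => R ^ p) (volume.restrict E) :=
    integrableOn_const hfin
  have key : ∫ y in E, k y ≤ ∫ y in E, ((ball x r).indicator k y
      + (ball x R).indicator (fun _ => r ^ p) y + R ^ p) := by
    refine integral_mono_of_nonneg (Eventually.of_forall hk) ((i1.add i2).add i3)
      (Eventually.of_forall fun y => ?_)
    have hr' : 0 ≤ r ^ p := by positivity
    have hR' : 0 ≤ R ^ p := by positivity
    have hi : 0 ≤ (ball x R).indicator (fun _ => r ^ p) y :=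
      Set.indicator_nonneg (fun _ _ => hr') y
    by_cases h1 : y ∈ ball x r
    · simp only [Set.indicator_of_mem h1]
      linarith
    · simp only [Set.indicator_of_notMem h1, zero_add]
      rw [mem_ball, not_lt, dist_eq_norm] at h1
      by_cases h2 : y ∈ ball x R
      · rw [Set.indicator_of_mem h2]
        have : k y ≤ r ^ p := Real.rpow_le_rpow_of_nonpos hr h1 hp
        linarith
      · rw [Set.indicator_of_notMem h2]
        rw [mem_ball, not_lt, dist_eq_norm] at h2
        have : k y ≤ R ^ p := Real.rpow_le_rpow_of_nonpos hR h2 hp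
        linarith
  refine key.trans ?_
  have hsplit := integral_add (i1.add i2) i3
  simp only [Pi.add_apply] at hsplit
  rw [hsplit, integral_add i1 i2]
  refine add_le_add (add_le_add ?_ ?_) ?_
  · rw [← setIntegral_riesz_kernel_ball x r, ← integral_indicator measurableSet_ball]
    exact setIntegral_le_integral ((integrable_indicator_iff measurableSet_ball).2 hint)
      (Eventually.of_forall fun y => Set.indicator_nonneg (fun _ _ => hk _) y)
  · rw [integral_indicator measurableSet_ball, Measure.restrict_restrict measurableSet_ball,
      setIntegral_const, smul_eq_mul, mul_comm, Set.inter_comm]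
  · rw [setIntegral_const, smul_eq_mul, mul_comm]

lemma rieszEnergy_le_of_potential_le {E : Set (EuclideanSpace ℝ (Fin N))}
    (hfin : volume E ≠ ⊤) {C : ℝ} (h : ∀ x, ∫ y in E, ‖y - x‖ ^ (α - (N : ℝ)) ≤ C) :
    rieszEnergy N α E ≤ C * volume.real E := by
  refine (Real.le_norm_self _).trans
    (norm_setIntegral_le_of_norm_le_const hfin.lt_top fun x _ => ?_)
  rw [Real.norm_of_nonneg (integral_nonneg fun _ => by positivity)]
  exact h x

lemma le_rieszEnergy_ball (hN : 1 ≤ N) (hα : 0 < α) (hα' : α < N) :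
    (2 : ℝ) ^ (α - (N : ℝ)) * omegaN N ^ 2 ≤
      rieszEnergy N α (ball (0 : EuclideanSpace ℝ (Fin N)) 1) := by
  have : Nontrivial (EuclideanSpace ℝ (Fin N)) :=
    Module.nontrivial_of_finrank_pos (R := ℝ) (by simpa using Nat.succ_le_iff.1 hN)
  set B := ball (0 : EuclideanSpace ℝ (Fin N)) 1
  have hB : volume B ≠ ⊤ := measure_ball_lt_top.ne
  have hω : omegaN N = volume.real B := rfl
  have inner_ge : ∀ x ∈ B, (2 : ℝ) ^ (α - (N : ℝ)) * omegaN N ≤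
      ∫ y in B, ‖y - x‖ ^ (α - (N : ℝ)) := by
    intro x hx
    have hsub : B ⊆ ball x 2 := by
      intro y hy
      have := dist_triangle_right y x 0
      rw [mem_ball] at *
      linarith
    have hc : (2 : ℝ) ^ (α - (N : ℝ)) * omegaN N = ∫ _ in B, (2 : ℝ) ^ (α - (N : ℝ)) := by
      rw [setIntegral_const, smul_eq_mul, mul_comm, hω]
    rw [hc]
    refine setIntegral_mono_on_ae (integrableOn_const hB)
      ((integrableOn_riesz_kernel_ball hN hα x 2).mono_set hsub) measurableSet_ball ?_
    filter_upwards [Measure.ae_ne volume x] with y hy hyB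
    have h2 := hsub hyB
    rw [mem_ball, dist_eq_norm] at h2
    exact Real.rpow_le_rpow_of_nonpos (norm_pos_iff.2 (sub_ne_zero.2 hy)) h2.le (by linarith)
  have hmeas : StronglyMeasurable fun x : EuclideanSpace ℝ (Fin N) =>
      ∫ y in B, ‖y - x‖ ^ (α - (N : ℝ)) := by
    refine StronglyMeasurable.integral_prod_right
      (f := fun x y : EuclideanSpace ℝ (Fin N) => ‖y - x‖ ^ (α - (N : ℝ))) ?_
    exact (by fun_prop : Measurable _).stronglyMeasurable
  have hint : IntegrableOn (fun x => ∫ y in B, ‖y - x‖ ^ (α - (N : ℝ))) B := by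
    refine Integrable.mono' (integrableOn_const hB (C :=
      (∫ z in ball (0 : EuclideanSpace ℝ (Fin N)) 1, ‖z‖ ^ (α - (N : ℝ)))
        + 1 ^ (α - (N : ℝ)) * volume.real B + 1 ^ (α - (N : ℝ)) * volume.real B))
      hmeas.aestronglyMeasurable (Eventually.of_forall fun x => ?_)
    rw [Real.norm_of_nonneg (integral_nonneg fun _ => by positivity)]
    refine (riesz_potential_le hN hα hα' hB x one_pos one_pos).trans ?_
    gcongr
    exact Set.inter_subset_left
  have := setIntegral_ge_of_const_le_real measurableSet_ball hB inner_ge hint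
  rw [← hω] at this
  rw [pow_two, ← mul_assoc]
  exact this

end RieszPotential

section Sparse

variable {N : ℕ}

lemma measureReal_inter_ball_le_of_asymmetry {E : Set (EuclideanSpace ℝ (Fin N))}
    (hE : MeasurableSet E)
    (hvol : volume E = volume (ball (0 : EuclideanSpace ℝ (Fin N)) 1)) {ξ : ℝ}
    (h : 2 * (omegaN N - ξ) ≤ asymmetry N E) (x : EuclideanSpace ℝ (Fin N)) :
    volume.real (E ∩ ball x 1) ≤ ξ := by
  have h1 : asymmetry N E ≤ volume.real (ball x 1 ∆ E) :=
    ciInf_le ⟨0, by rintro _ ⟨y, rfl⟩; exact ENNReal.toReal_nonneg⟩ x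
  have hfin : volume E ≠ ⊤ := hvol ▸ measure_ball_lt_top.ne
  have hEω : volume.real E = omegaN N := by rw [Measure.real, hvol, omegaN]
  have hBω : volume.real (ball x 1) = omegaN N := Measure.addHaar_real_ball_center volume x 1
  have h2 : volume.real (ball x 1 ∆ E) ≤
      volume.real (ball x 1 \ E) + volume.real (E \ ball x 1) := measureReal_union_le _ _
  have h3 := measureReal_inter_add_sdiff (measurableSet_ball (x := x) (ε := 1)) hfin
  have h4 := measureReal_inter_add_sdiff hE (measure_ball_lt_top (μ := volume) (x := x) (r := 1)).ne
  rw [Set.inter_comm] at h4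
  linarith

lemma exists_measureReal_inter_ball_le (N : ℕ) (R : ℝ) :
    ∃ M : ℕ, ∀ (E : Set (EuclideanSpace ℝ (Fin N))) (ξ : ℝ), volume E ≠ ⊤ →
      (∀ x, volume.real (E ∩ ball x 1) ≤ ξ) → ∀ x, volume.real (E ∩ ball x R) ≤ M * ξ := by
  obtain ⟨t, -, ht, hcov⟩ :=
    (isCompact_closedBall (0 : EuclideanSpace ℝ (Fin N)) R).finite_cover_balls one_pos
  lift t to Finset (EuclideanSpace ℝ (Fin N)) using ht
  refine ⟨t.card, fun E ξ hE h x => ?_⟩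
  have hsub : E ∩ ball x R ⊆ ⋃ c ∈ t, E ∩ ball (x + c) 1 := by
    rintro y ⟨hyE, hy⟩
    have hy' : y - x ∈ closedBall (0 : EuclideanSpace ℝ (Fin N)) R := by
      rw [mem_closedBall, dist_zero_right, ← dist_eq_norm]
      exact (mem_ball.1 hy).le
    obtain ⟨c, hc, hyc⟩ := Set.mem_iUnion₂.1 (hcov hy')
    refine Set.mem_iUnion₂.2 ⟨c, hc, hyE, ?_⟩
    rw [mem_ball, dist_eq_norm] at hyc ⊢
    rwa [← sub_sub]
  calc volume.real (E ∩ ball x R) ≤ volume.real (⋃ c ∈ t, E ∩ ball (x + c) 1) :=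
        measureReal_mono hsub (measure_ne_top_of_subset
          (Set.iUnion₂_subset fun _ _ => Set.inter_subset_left) hE)
    _ ≤ ∑ c ∈ t, volume.real (E ∩ ball (x + c) 1) := measureReal_biUnion_finset_le _ _
    _ ≤ ∑ _ ∈ t, ξ := Finset.sum_le_sum fun c _ => h _
    _ = t.card * ξ := by simp

end Sparse

lemma one_sub_two_rpow_div_five_pow_lt {N : ℕ} {α : ℝ} (hα : 0 < α) :
    (1 - (2 : ℝ) ^ (α - (N : ℝ))) / 5 ^ N < (2 : ℝ) ^ (α - (N : ℝ)) := by
  have h2 : (1 : ℝ) / 2 ^ N < 2 ^ (α - (N : ℝ)) := by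
    rw [one_div, ← Real.rpow_natCast, ← Real.rpow_neg (by norm_num)]
    exact Real.rpow_lt_rpow_of_exponent_lt (by norm_num) (by linarith)
  have h0 : (0 : ℝ) < 2 ^ (α - (N : ℝ)) := by positivity
  calc (1 - (2 : ℝ) ^ (α - (N : ℝ))) / 5 ^ N ≤ 1 / 5 ^ N := by gcongr; linarith
    _ ≤ 1 / 2 ^ N := by gcongr; norm_num
    _ < _ := h2

theorem sparse_sets_have_large_deficit (N : ℕ) (hN : 2 ≤ N) (α : ℝ) (hα₁ : 1 < α)
    (hα₂ : α < N) :
    ∃ ξ : ℝ, 0 < ξ ∧ ∀ E : Set (EuclideanSpace ℝ (Fin N)), MeasurableSet E →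
      volume E = volume (ball (0 : EuclideanSpace ℝ (Fin N)) 1) →
      2 * (omegaN N - ξ) ≤ asymmetry N E →
      omegaN N ^ 2 / 5 ^ N * (1 - (2 : ℝ) ^ (-((N : ℝ) - α))) < deficit N α E := by
  have hN1 : 1 ≤ N := by lia
  have hα : 0 < α := by linarith
  rw [neg_sub]
  have hω : 0 < omegaN N :=
    ENNReal.toReal_pos (measure_ball_pos _ _ one_pos).ne' measure_ball_lt_top.ne
  obtain ⟨c, hc⟩ : ∃ c, c = (2 : ℝ) ^ (α - (N : ℝ)) - (1 - (2 : ℝ) ^ (α - (N : ℝ))) / 5 ^ N :=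
    ⟨_, rfl⟩
  have hc0 : 0 < c := by rw [hc]; exact sub_pos.2 (one_sub_two_rpow_div_five_pow_lt hα)
  have hε : 0 < c * omegaN N / 4 := by positivity
  obtain ⟨r, hrI, hr⟩ := (((tendsto_setIntegral_riesz_kernel_ball hN1 hα).eventually_lt_const
    hε).and self_mem_nhdsWithin).exists
  replace hr : 0 < r := hr
  obtain ⟨R, hRc, hR⟩ : ∃ R : ℝ, R ^ (α - (N : ℝ)) < c / 4 ∧ 0 < R := by
    have := tendsto_rpow_neg_atTop (sub_pos.2 hα₂)
    rw [neg_sub] at this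
    exact ((this.eventually_lt_const (by positivity)).and (eventually_gt_atTop 0)).exists
  obtain ⟨M, hM⟩ := exists_measureReal_inter_ball_le N R
  have hrp : 0 < r ^ (α - (N : ℝ)) := by positivity
  refine ⟨c * omegaN N / 4 / (r ^ (α - (N : ℝ)) * (M + 1)), by positivity,
    fun E hE hvol hasym => ?_⟩
  set ξ := c * omegaN N / 4 / (r ^ (α - (N : ℝ)) * (M + 1)) with hξ
  have hξ0 : 0 < ξ := by positivity
  have hfin : volume E ≠ ⊤ := hvol ▸ measure_ball_lt_top.ne
  have hEω : volume.real E = omegaN N := by rw [Measure.real, hvol, omegaN]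
  have hpot : ∀ x, ∫ y in E, ‖y - x‖ ^ (α - (N : ℝ)) ≤ 3 / 4 * (c * omegaN N) := by
    intro x
    have h1 := riesz_potential_le hN1 hα hα₂ hfin x hr hR
    have h2 : r ^ (α - (N : ℝ)) * volume.real (E ∩ ball x R) ≤ c * omegaN N / 4 :=
      calc r ^ (α - (N : ℝ)) * volume.real (E ∩ ball x R)
          ≤ r ^ (α - (N : ℝ)) * ((M + 1) * ξ) := by
            gcongr
            exact (hM E ξ hfin (measureReal_inter_ball_le_of_asymmetry hE hvol hasym) x).trans
              (by gcongr; linarith)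
        _ = c * omegaN N / 4 := by rw [hξ]; field_simp
    have h3 : R ^ (α - (N : ℝ)) * volume.real E ≤ c / 4 * omegaN N := by
      rw [hEω]; gcongr
    linarith
  have hup := rieszEnergy_le_of_potential_le hfin hpot
  rw [hEω] at hup
  have hlow := le_rieszEnergy_ball hN1 hα hα₂
  have hid : omegaN N ^ 2 / 5 ^ N * (1 - (2 : ℝ) ^ (α - (N : ℝ)))
      = (2 : ℝ) ^ (α - (N : ℝ)) * omegaN N ^ 2 - c * omegaN N ^ 2 := by
    rw [hc]; ring
  have hpos : 0 < c * omegaN N ^ 2 := by positivity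
  rw [hid, deficit]
  linarith
end

section
/- Let N ≥ 2 and 1 < α < N. One has the lower bound 𝔉(B) ≥ ω_N²/2^{N−α} + (ω_N²/4^N)·(1 − 2^{−(N−α)}), where B is the unit ball of ℝ^N. -/
open MeasureTheory Metric

lemma preimage_sub_const_ball {E : Type*} [SeminormedAddCommGroup E] (x : E) (r : ℝ) :
    (fun y ↦ y - x) ⁻¹' ball 0 r = ball x r := by
  ext y
  simp [dist_eq_norm]

lemma integrableOn_ball_norm_sub_rpow {N : ℕ} (hN : 1 ≤ N) {p : ℝ} (hp : -(N : ℝ) < p)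
    (x : EuclideanSpace ℝ (Fin N)) (r : ℝ) :
    IntegrableOn (fun y ↦ ‖y - x‖ ^ p) (ball x r) := by
  have h0 : IntegrableOn (fun z : EuclideanSpace ℝ (Fin N) ↦ ‖z‖ ^ p) (ball 0 r) := by
    refine integrableOn_ball_of_norm_le_rpow (C := 1) (α := -p) (by simpa using hN)
      (by simpa using neg_lt.mp hp) (.of_forall fun z ↦ ?_)
      (measurable_norm.pow_const p).aestronglyMeasurable
    rw [Real.norm_of_nonneg (by positivity), neg_neg, one_mul]
  have h := ((measurePreserving_sub_right volume x).integrableOn_comp_preimage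
    (measurableEmbedding_subRight x) (s := ball 0 r)).mpr h0
  rwa [preimage_sub_const_ball] at h

lemma setIntegral_ball_norm_sub_rpow {N : ℕ} (p : ℝ) (x : EuclideanSpace ℝ (Fin N)) (r : ℝ) :
    ∫ y in ball x r, ‖y - x‖ ^ p = ∫ z in ball (0 : EuclideanSpace ℝ (Fin N)) r, ‖z‖ ^ p := by
  have h := (measurePreserving_sub_right volume x).setIntegral_preimage_emb
    (measurableEmbedding_subRight x) (fun z ↦ ‖z‖ ^ p) (ball 0 r)
  rwa [preimage_sub_const_ball] at h

lemma ball_zero_subset_ball_add {N : ℕ} {x : EuclideanSpace ℝ (Fin N)} {r : ℝ}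
    (hx : x ∈ ball (0 : EuclideanSpace ℝ (Fin N)) r) : ball 0 r ⊆ ball x (r + r) :=
  ball_subset_ball' (by rw [dist_comm]; linarith [mem_ball.mp hx])

lemma integrableOn_ball_rieszPotential {N : ℕ} (hN : 1 ≤ N) {p : ℝ} (hp : -(N : ℝ) < p) (r : ℝ) :
    IntegrableOn (fun x ↦ ∫ y in ball (0 : EuclideanSpace ℝ (Fin N)) r, ‖y - x‖ ^ p)
      (ball 0 r) := by
  have hmeas : StronglyMeasurable
      (fun x ↦ ∫ y in ball (0 : EuclideanSpace ℝ (Fin N)) r, ‖y - x‖ ^ p) := by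
    refine StronglyMeasurable.integral_prod_right (f := fun x y ↦ ‖y - x‖ ^ p) ?_
    exact Measurable.stronglyMeasurable
      ((measurable_snd.sub measurable_fst).norm.pow_const p)
  refine IntegrableOn.of_bound measure_ball_lt_top hmeas.aestronglyMeasurable
    (∫ z in ball (0 : EuclideanSpace ℝ (Fin N)) (r + r), ‖z‖ ^ p)
    (ae_restrict_of_forall_mem measurableSet_ball fun x hx ↦ ?_)
  rw [Real.norm_of_nonneg (integral_nonneg fun y ↦ by positivity),
    ← setIntegral_ball_norm_sub_rpow p x]
  exact setIntegral_mono_set (integrableOn_ball_norm_sub_rpow hN hp x _)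
    (.of_forall fun y ↦ by positivity) (ball_zero_subset_ball_add hx).eventuallyLE

lemma norm_sub_rpow_lower_bound {N : ℕ} {p : ℝ} (hp : p ≤ 0)
    {x y : EuclideanSpace ℝ (Fin N)} (hx : x ∈ ball (0 : EuclideanSpace ℝ (Fin N)) 1)
    (hy : y ∈ ball (0 : EuclideanSpace ℝ (Fin N)) 1) (hxy : y ≠ x) :
    (2 : ℝ) ^ p + (1 - 2 ^ p) *
        ((ball (0 : EuclideanSpace ℝ (Fin N)) (1 / 2)).indicator 1 x *
          (ball (0 : EuclideanSpace ℝ (Fin N)) (1 / 2)).indicator 1 y) ≤ ‖y - x‖ ^ p := by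
  have hpos : 0 < ‖y - x‖ := norm_pos_iff.mpr (sub_ne_zero.mpr hxy)
  have htri : ‖y - x‖ ≤ ‖y‖ + ‖x‖ := norm_sub_le y x
  rw [mem_ball_zero_iff] at hx hy
  by_cases h : ‖x‖ < 1 / 2 ∧ ‖y‖ < 1 / 2
  · rw [Set.indicator_of_mem (mem_ball_zero_iff.mpr h.1),
      Set.indicator_of_mem (mem_ball_zero_iff.mpr h.2)]
    simpa using Real.one_le_rpow_of_pos_of_le_one_of_nonpos hpos (by linarith [h.1, h.2]) hp
  · have hzero : (ball (0 : EuclideanSpace ℝ (Fin N)) (1 / 2)).indicator (1 : EuclideanSpace ℝ (Fin N) → ℝ) x *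
        (ball (0 : EuclideanSpace ℝ (Fin N)) (1 / 2)).indicator 1 y = 0 := by
      rcases not_and_or.mp h with h | h
      · rw [Set.indicator_of_notMem (a := x) (by rwa [mem_ball_zero_iff]), zero_mul]
      · rw [Set.indicator_of_notMem (a := y) (by rwa [mem_ball_zero_iff]), mul_zero]
    rw [hzero, mul_zero, add_zero]
    exact Real.rpow_le_rpow_of_nonpos hpos (by linarith) hp

lemma integrable_indicator_ball_one {N : ℕ} (r : ℝ) :
    Integrable ((ball (0 : EuclideanSpace ℝ (Fin N)) r).indicator (1 : EuclideanSpace ℝ (Fin N) → ℝ)) :=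
  (integrable_indicator_iff measurableSet_ball).mpr
    (integrableOn_const (C := (1 : ℝ)) measure_ball_lt_top.ne)

lemma setIntegral_indicator_half_ball {N : ℕ} :
    ∫ y in ball (0 : EuclideanSpace ℝ (Fin N)) 1,
      (ball (0 : EuclideanSpace ℝ (Fin N)) (1 / 2)).indicator (1 : EuclideanSpace ℝ (Fin N) → ℝ) y =
        omegaN N / 2 ^ N := by
  rw [setIntegral_indicator measurableSet_ball,
    Set.inter_eq_right.mpr (ball_subset_ball (by norm_num))]
  simp only [Pi.one_apply, integral_const, smul_eq_mul, mul_one, measureReal_def,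
    Measure.restrict_apply_univ]
  rw [Measure.addHaar_ball_of_pos _ _ (by norm_num : (0 : ℝ) < 1 / 2), ENNReal.toReal_mul,
    ENNReal.toReal_ofReal (by positivity), finrank_euclideanSpace_fin, omegaN, one_div, inv_pow,
    inv_mul_eq_div]

lemma setIntegral_ball_const_add_mul_indicator {N : ℕ} (a b : ℝ) :
    ∫ y in ball (0 : EuclideanSpace ℝ (Fin N)) 1,
      (a + b * (ball (0 : EuclideanSpace ℝ (Fin N)) (1 / 2)).indicator (1 : EuclideanSpace ℝ (Fin N) → ℝ) y) =
        a * omegaN N + b * (omegaN N / 2 ^ N) := by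
  rw [integral_add (integrableOn_const (C := a) measure_ball_lt_top.ne)
    ((integrable_indicator_ball_one _).integrableOn.const_mul b), integral_const_mul,
    setIntegral_indicator_half_ball]
  simp [measureReal_def, omegaN, mul_comm]

lemma integrableOn_ball_const_add_mul_indicator {N : ℕ} (a b : ℝ) :
    IntegrableOn (fun y ↦ a + b *
      (ball (0 : EuclideanSpace ℝ (Fin N)) (1 / 2)).indicator (1 : EuclideanSpace ℝ (Fin N) → ℝ) y) (ball 0 1) :=
  Integrable.add (integrableOn_const (C := a) measure_ball_lt_top.ne)
    ((integrable_indicator_ball_one _).integrableOn.const_mul b)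

lemma rieszPotential_ball_lower_bound {N : ℕ} (hN : 1 ≤ N) {p : ℝ} (hp : -(N : ℝ) < p)
    (hp0 : p ≤ 0) {x : EuclideanSpace ℝ (Fin N)}
    (hx : x ∈ ball (0 : EuclideanSpace ℝ (Fin N)) 1) :
    2 ^ p * omegaN N + (1 - 2 ^ p) * (omegaN N / 2 ^ N) *
        (ball (0 : EuclideanSpace ℝ (Fin N)) (1 / 2)).indicator 1 x ≤
      ∫ y in ball (0 : EuclideanSpace ℝ (Fin N)) 1, ‖y - x‖ ^ p := by
  have : Nontrivial (EuclideanSpace ℝ (Fin N)) :=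
    Module.nontrivial_of_finrank_pos (R := ℝ) (by rw [finrank_euclideanSpace_fin]; omega)
  set c := (ball (0 : EuclideanSpace ℝ (Fin N)) (1 / 2)).indicator (1 : EuclideanSpace ℝ (Fin N) → ℝ) x
  calc _ = 2 ^ p * omegaN N + (1 - 2 ^ p) * c * (omegaN N / 2 ^ N) := by ring
    _ = _ := (setIntegral_ball_const_add_mul_indicator _ _).symm
    _ ≤ _ := by
      refine setIntegral_mono_on_ae (integrableOn_ball_const_add_mul_indicator _ _)
        ((integrableOn_ball_norm_sub_rpow hN hp x _).mono_set (ball_zero_subset_ball_add hx))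
        measurableSet_ball ?_
      filter_upwards [Measure.ae_ne volume x] with y hyx hy
      rw [mul_assoc]
      exact norm_sub_rpow_lower_bound hp0 hx hy hyx

theorem riesz_energy_ball_lower_bound (N : ℕ) (hN : 2 ≤ N) (α : ℝ) (hα₁ : 1 < α)
    (hα₂ : α < N) :
    omegaN N ^ 2 / (2 : ℝ) ^ ((N : ℝ) - α) +
        omegaN N ^ 2 / 4 ^ N * (1 - (2 : ℝ) ^ (-((N : ℝ) - α))) ≤
      rieszEnergy N α (ball (0 : EuclideanSpace ℝ (Fin N)) 1) := by
  have hN' : 1 ≤ N := by omega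
  have hp : -(N : ℝ) < α - N := by linarith
  have hpow : (4 : ℝ) ^ N = 2 ^ N * 2 ^ N := by rw [← mul_pow]; norm_num
  calc _ = 2 ^ (α - N) * omegaN N * omegaN N +
        (1 - 2 ^ (α - N)) * (omegaN N / 2 ^ N) * (omegaN N / 2 ^ N) := by
        rw [div_eq_mul_inv _ ((2 : ℝ) ^ ((N : ℝ) - α)), ← Real.rpow_neg zero_le_two, neg_sub, hpow]
        field_simp
    _ = _ := (setIntegral_ball_const_add_mul_indicator _ _).symm
    _ ≤ _ := setIntegral_mono_on (integrableOn_ball_const_add_mul_indicator _ _)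
        (integrableOn_ball_rieszPotential hN' hp 1) measurableSet_ball
        fun x hx ↦ rieszPotential_ball_lower_bound hN' hp (by linarith) hx
end
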